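/- arXiv:1806.07579 — 9 statements merged into one kernel-verified Lean document; each statement's English description precedes it below -/
import Mathlib

section
/- Let d = s(q−1) + Δ and suppose gcd(Δ, q−1) = 1. Then the degree of the minimal polynomial of γ^{−d} over F_p equals m if Δ ≡ 2s (mod q+1), and equals 2m otherwise. -/
/-- An element of an extension of a finite field `K` has degree dividing `n` over `K` exactly when
it is fixed by the `n`-th power of the Frobenius of `K`. -/
theorem FiniteField.natDegree_minpoly_dvd_iff {K L : Type*} [Field K] [Finite K] [Field L]
    [Algebra K L] {x : L} (hx : IsIntegral K x) (n : ℕ) :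
    (minpoly K x).natDegree ∣ n ↔ x ^ Nat.card K ^ n = x := by
  rw [(minpoly.irreducible hx).natDegree_dvd_iff_dvd_X_pow_card_pow_sub_X, minpoly.dvd_iff]
  simp [sub_eq_zero]

/-- If `a ^ m - 1` divides `a ^ n - 1`, then `m` divides `n`. -/
theorem Nat.dvd_of_pow_sub_one_dvd_pow_sub_one {a m n : ℕ} (ha : 1 < a)
    (h : a ^ m - 1 ∣ a ^ n - 1) : m ∣ n := by
  have hg := Nat.pow_sub_one_gcd_pow_sub_one a m n
  rw [Nat.gcd_eq_left h] at hg
  have hm : a ^ m = a ^ m.gcd n := by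
    have := Nat.one_le_pow m a (by omega)
    have := Nat.one_le_pow (m.gcd n) a (by omega)
    omega
  exact Nat.gcd_eq_left_iff_dvd.mp (Nat.pow_right_injective ha hm).symm

/-- Lemma 1(1): Let `p` be a prime, `m ≥ 1`, `q = p^m`, `F` the finite field with `q²`
elements and `γ` a generator of `Fˣ`.  If `d = s(q-1) + Δ` with `gcd(Δ, q-1) = 1`, then the
degree of the minimal polynomial of `γ^{-d}` over `F_p` equals `m` if `Δ ≡ 2s (mod q+1)`,
and equals `2m` otherwise. -/
theorem stmt_0 (p m : ℕ) (hp : p.Prime) (hm : 0 < m) (q : ℕ) (hq : q = p ^ m)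
    (F : Type*) [Field F] [Fintype F] [Algebra (ZMod p) F]
    (hF : Fintype.card F = q ^ 2)
    (γ : Fˣ) (hγ : ∀ x : Fˣ, x ∈ Subgroup.zpowers γ)
    (d s Δ : ℤ) (hΔ : Int.gcd Δ ((q : ℤ) - 1) = 1)
    (hd : d = s * ((q : ℤ) - 1) + Δ) :
    (Δ ≡ 2 * s [ZMOD ((q : ℤ) + 1)] →
      (minpoly (ZMod p) ((γ ^ (-d) : Fˣ) : F)).natDegree = m) ∧
    (¬ Δ ≡ 2 * s [ZMOD ((q : ℤ) + 1)] →
      (minpoly (ZMod p) ((γ ^ (-d) : Fˣ) : F)).natDegree = 2 * m) := by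
  have : Fact p.Prime := ⟨hp⟩
  have hq1 : 1 < q := hq ▸ Nat.one_lt_pow hm.ne' hp.one_lt
  have horder : (orderOf γ : ℤ) = ((q : ℤ) - 1) * (q + 1) := by
    rw [orderOf_eq_card_of_forall_mem_zpowers hγ, Nat.card_units, Nat.card_eq_fintype_card, hF,
      Nat.cast_sub (Nat.one_le_pow _ _ (by omega))]
    push_cast
    ring
  have hdeg (n : ℕ) : (minpoly (ZMod p) ((γ ^ (-d) : Fˣ) : F)).natDegree ∣ n ↔
      ((q : ℤ) - 1) * (q + 1) ∣ d * ((p : ℤ) ^ n - 1) := by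
    rw [FiniteField.natDegree_minpoly_dvd_iff (.of_finite _ _), Nat.card_zmod, ← horder,
      orderOf_dvd_iff_zpow_eq_one, ← Units.val_pow_eq_pow_val, Units.val_inj, ← zpow_natCast,
      ← zpow_mul, ← mul_inv_eq_one, ← zpow_neg, ← zpow_add, ← inv_eq_one, ← zpow_neg]
    push_cast
    ring_nf
  have hqm : (p : ℤ) ^ m = q := by rw [hq]; push_cast; rfl
  have hcop : IsCoprime ((q : ℤ) - 1) d := by
    rw [hd, IsCoprime.mul_add_right_right_iff]
    exact (Int.isCoprime_iff_gcd_eq_one.mpr hΔ).symm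
  have hpos : (q : ℤ) - 1 ≠ 0 := by omega
  have hm_iff : (minpoly (ZMod p) ((γ ^ (-d) : Fˣ) : F)).natDegree ∣ m ↔
      Δ ≡ 2 * s [ZMOD ((q : ℤ) + 1)] := by
    rw [hdeg, hqm, mul_comm d, mul_dvd_mul_iff_left hpos, Int.modEq_comm, Int.modEq_iff_dvd,
      show d = s * (q + 1) + (Δ - 2 * s) by rw [hd]; ring, dvd_add_right (dvd_mul_left _ _)]
  have hdvd_two : (minpoly (ZMod p) ((γ ^ (-d) : Fˣ) : F)).natDegree ∣ m * 2 := by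
    rw [hdeg, pow_mul, hqm]
    exact Dvd.intro_left d (by ring)
  have hdvd : m ∣ (minpoly (ZMod p) ((γ ^ (-d) : Fˣ) : F)).natDegree := by
    have h := hcop.dvd_of_dvd_mul_left ((dvd_mul_right _ _).trans ((hdeg _).mp dvd_rfl))
    refine Nat.dvd_of_pow_sub_one_dvd_pow_sub_one hp.one_lt (Int.natCast_dvd_natCast.mp ?_)
    rw [Nat.cast_sub (Nat.one_le_pow _ _ hp.pos), Nat.cast_sub (Nat.one_le_pow _ _ hp.pos)]
    rwa [Nat.cast_pow, Nat.cast_pow, hqm, Nat.cast_one]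
  refine ⟨fun h ↦ Nat.dvd_antisymm (hm_iff.mpr h) hdvd, fun h ↦ ?_⟩
  obtain ⟨k, hk⟩ := hdvd
  rw [hk] at hdvd_two hm_iff ⊢
  rcases (Nat.dvd_prime Nat.prime_two).mp (Nat.dvd_of_mul_dvd_mul_left hm hdvd_two) with rfl | rfl
  · exact absurd (hm_iff.mp (by simp)) h
  · exact mul_comm m 2
end

section
/- For any t with 0 ≤ t < (q+1)/(2e), the minimal polynomial of γ^{−d_0} over F_2 has degree m, the minimal polynomial of γ^{−d_i} over F_2 has degree 2m for every 1 ≤ i ≤ t, and the minimal polynomials of γ^{−d_i} and γ^{−d_j} are distinct for all 0 ≤ i ≠ j ≤ t. -/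
open Polynomial in
theorem natDegree_minpoly_zmod_two_dvd_iff {F : Type*} [Field F] [Finite F] [Algebra (ZMod 2) F]
    (x : F) (n : ℕ) : (minpoly (ZMod 2) x).natDegree ∣ n ↔ x ^ 2 ^ n = x := by
  have hx : IsIntegral (ZMod 2) x := Algebra.IsIntegral.isIntegral x
  rw [(minpoly.irreducible hx).natDegree_dvd_iff_dvd_X_pow_card_pow_sub_X, minpoly.dvd_iff]
  simp [sub_eq_zero]

theorem exists_eq_pow_two_pow_of_minpoly_eq {F : Type*} [Field F] [Finite F] [Algebra (ZMod 2) F]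
    {x y : F} (hxy : minpoly (ZMod 2) x = minpoly (ZMod 2) y) : ∃ n : ℕ, x ^ 2 ^ n = y := by
  obtain ⟨σ, hσ⟩ := minpoly.exists_algEquiv_of_root' (Algebra.IsAlgebraic.isAlgebraic x)
    (hxy ▸ minpoly.aeval (ZMod 2) y)
  obtain ⟨n, rfl⟩ := (FiniteField.bijective_frobeniusAlgEquivOfAlgebraic_pow (ZMod 2) F).2 σ
  refine ⟨n, ?_⟩
  rw [← hσ, AlgEquiv.coe_pow, FiniteField.coe_frobeniusAlgEquivOfAlgebraic_iterate, ZMod.card]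

theorem zpow_neg_pow_two_pow_eq_iff {F : Type*} [Field F] (γ : Fˣ) (a b : ℤ) (n : ℕ) :
    ((γ ^ (-a) : Fˣ) : F) ^ 2 ^ n = ((γ ^ (-b) : Fˣ) : F) ↔
      a * 2 ^ n ≡ b [ZMOD orderOf γ] := by
  rw [← Units.val_pow_eq_pow_val, Units.val_inj, ← zpow_natCast, ← zpow_mul,
    zpow_eq_zpow_iff_modEq, neg_mul, Int.neg_modEq_neg]
  push_cast
  rfl

theorem dvd_of_two_pow_modEq_one {m n : ℕ} (h : (2 : ℤ) ^ n ≡ 1 [ZMOD 2 ^ m - 1]) : m ∣ n := by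
  have hdvd : 2 ^ m - 1 ∣ 2 ^ n - 1 := by
    zify [Nat.one_le_two_pow]
    exact h.symm.dvd
  have hgcd := Nat.pow_sub_one_gcd_pow_sub_one 2 m n
  rw [Nat.gcd_eq_left hdvd] at hgcd
  have hpow : 2 ^ m = 2 ^ m.gcd n := by
    have := Nat.one_le_two_pow (n := m)
    have := Nat.one_le_two_pow (n := m.gcd n)
    omega
  exact Nat.gcd_eq_left_iff_dvd.1 (Nat.pow_right_injective le_rfl hpow).symm

theorem two_pow_modEq_one_or_neg_one {m n : ℕ} (h : m ∣ n) :
    (2 : ℤ) ^ n ≡ 1 [ZMOD 2 ^ m + 1] ∨ (2 : ℤ) ^ n ≡ -1 [ZMOD 2 ^ m + 1] := by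
  obtain ⟨k, rfl⟩ := h
  have hneg : (2 : ℤ) ^ m ≡ -1 [ZMOD 2 ^ m + 1] := (Int.modEq_iff_dvd.2 ⟨1, by ring⟩ : _).symm
  rw [pow_mul]
  rcases neg_one_pow_eq_or ℤ k with hk | hk
  · exact .inl ((hneg.pow k).trans (by rw [hk]))
  · exact .inr ((hneg.pow k).trans (by rw [hk]))

theorem dvd_of_mul_two_pow_modEq {m n Δ : ℕ} (hΔ : Δ.gcd (2 ^ m - 1) = 1) {a b : ℤ}
    (ha : a ≡ Δ [ZMOD 2 ^ m - 1]) (hb : b ≡ Δ [ZMOD 2 ^ m - 1])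
    (hab : a * 2 ^ n ≡ b [ZMOD 2 ^ m - 1]) : m ∣ n := by
  have hcop : IsCoprime (2 ^ m - 1 : ℤ) Δ := by
    have := Nat.isCoprime_iff_coprime.2 (Nat.Coprime.symm hΔ)
    push_cast [Nat.one_le_two_pow] at this
    exact this
  have hmod : (Δ : ℤ) * 2 ^ n ≡ Δ [ZMOD 2 ^ m - 1] :=
    ((ha.mul_right _).symm.trans hab).trans hb
  refine dvd_of_two_pow_modEq_one (Int.modEq_iff_dvd.2 (hcop.dvd_of_dvd_mul_left ?_))
  obtain ⟨c, hc⟩ := hmod.dvd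
  exact ⟨c, by linear_combination hc⟩

theorem eq_zero_of_dvd_two_mul_mul {m h : ℕ} (hm : 0 < m) {k : ℤ}
    (hk : ((h.gcd (2 ^ m + 1) : ℕ) : ℤ) * |k| < 2 ^ m + 1)
    (hdvd : (2 ^ m + 1 : ℤ) ∣ 2 * h * k) : k = 0 := by
  have hcop : IsCoprime (2 ^ m + 1 : ℤ) 2 := by
    obtain ⟨r, rfl⟩ := Nat.exists_eq_add_of_lt hm
    exact ⟨1, -2 ^ r, by ring⟩
  have hdvd' : (2 ^ m + 1 : ℤ) ∣ h * k := hcop.dvd_of_dvd_mul_left (by rwa [← mul_assoc])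
  have hdvd_gcd : (2 ^ m + 1 : ℤ) ∣ (h.gcd (2 ^ m + 1) : ℕ) * k := by
    rw [Nat.gcd_eq_gcd_ab, add_mul]
    refine dvd_add ?_ ⟨(h.gcdB (2 ^ m + 1)) * k, by push_cast; ring⟩
    convert hdvd'.mul_right (h.gcdA (2 ^ m + 1)) using 1
    ring
  have habs := Int.eq_zero_of_abs_lt_dvd hdvd_gcd (by rwa [abs_mul, Nat.abs_cast])
  have hgcd : h.gcd (2 ^ m + 1) ≠ 0 := Nat.gcd_ne_zero_right (by positivity)
  exact (mul_eq_zero.1 habs).resolve_left (by exact_mod_cast hgcd)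


/-- Lemma 2(1): Let `p = 2`, `q = 2^m`, `F` the field with `q²` elements, `γ` a generator of
`Fˣ`; `h, Δ` positive integers with `h ≢ 0 (mod q+1)`, `gcd(Δ, q-1) = 1`, and
`e = gcd(h, q+1)`.  Let `d_j ≡ s_j(q-1) + Δ (mod q²-1)` where `s_j ≡ j·h + Δ·2⁻¹ (mod q+1)`
(encoded as `2 s_j ≡ 2jh + Δ (mod q+1)`, since `q+1` is odd).  Then for `0 ≤ t < (q+1)/(2e)`,
the minimal polynomial of `γ^{-d_0}` over `F_2` has degree `m`, the minimal polynomial of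
`γ^{-d_i}` has degree `2m` for `1 ≤ i ≤ t`, and the minimal polynomials of `γ^{-d_i}` and
`γ^{-d_j}` are distinct for `0 ≤ i ≠ j ≤ t`. -/
theorem stmt_2 (m : ℕ) (hm : 0 < m) (q : ℕ) (hq : q = 2 ^ m)
    (F : Type*) [Field F] [Fintype F] [Algebra (ZMod 2) F]
    (hF : Fintype.card F = q ^ 2)
    (γ : Fˣ) (hγ : ∀ x : Fˣ, x ∈ Subgroup.zpowers γ)
    (h Δ : ℕ) (hh : 0 < h) (hΔpos : 0 < Δ)
    (hhq : ¬ (q + 1) ∣ h) (hΔ : Nat.gcd Δ (q - 1) = 1)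
    (e : ℕ) (he : e = Nat.gcd h (q + 1))
    (t : ℕ) (ht : 2 * e * t < q + 1)
    (d : ℕ → ℕ) (s : ℕ → ℤ)
    (hdpos : ∀ j ≤ t, 0 < d j)
    (hs : ∀ j ≤ t, 2 * s j ≡ 2 * (j : ℤ) * h + Δ [ZMOD ((q : ℤ) + 1)])
    (hd : ∀ j ≤ t, (d j : ℤ) ≡ s j * ((q : ℤ) - 1) + Δ [ZMOD ((q : ℤ) ^ 2 - 1)]) :
    (minpoly (ZMod 2) ((γ ^ (-(d 0 : ℤ)) : Fˣ) : F)).natDegree = m ∧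
    (∀ i, 1 ≤ i → i ≤ t →
      (minpoly (ZMod 2) ((γ ^ (-(d i : ℤ)) : Fˣ) : F)).natDegree = 2 * m) ∧
    (∀ i j, i ≤ t → j ≤ t → i ≠ j →
      minpoly (ZMod 2) ((γ ^ (-(d i : ℤ)) : Fˣ) : F) ≠
        minpoly (ZMod 2) ((γ ^ (-(d j : ℤ)) : Fˣ) : F)) := by
  subst hq he
  have hpow : (1 : ℤ) ≤ 2 ^ m := one_le_pow₀ (by norm_num)
  have hfact : ((2 ^ m : ℕ) : ℤ) ^ 2 - 1 = (2 ^ m - 1) * (2 ^ m + 1) := by push_cast; ring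
  have hord : (orderOf γ : ℤ) = (2 ^ m - 1) * (2 ^ m + 1) := by
    rw [← hfact, orderOf_eq_card_of_forall_mem_zpowers hγ, Nat.card_units,
      Nat.card_eq_fintype_card, hF, Nat.cast_sub (Nat.one_le_pow _ _ (by positivity))]
    push_cast
    rfl
  have hminus : ∀ j ≤ t, (d j : ℤ) ≡ Δ [ZMOD 2 ^ m - 1] := by
    intro j hj
    have hdj := hd j hj
    rw [hfact] at hdj
    refine (hdj.of_mul_right _).trans (Int.modEq_iff_dvd.2 ⟨-s j, ?_⟩)
    push_cast
    ring
  have hplus : ∀ j ≤ t, (d j : ℤ) ≡ -(2 * h * j) [ZMOD 2 ^ m + 1] := by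
    intro j hj
    have hdj := hd j hj
    rw [hfact] at hdj
    have hsj := hs j hj
    push_cast at hsj hdj
    refine (hdj.of_mul_left _).trans ?_
    obtain ⟨c, hc⟩ := hsj.dvd
    exact Int.modEq_iff_dvd.2 ⟨-s j - c, by linear_combination -hc⟩
  have hlt : ∀ k : ℤ, |k| ≤ 2 * t → ((h.gcd (2 ^ m + 1) : ℕ) : ℤ) * |k| < 2 ^ m + 1 := by
    intro k hk
    zify at ht
    nlinarith [Int.natCast_nonneg (h.gcd (2 ^ m + 1))]
  have hdvd : ∀ i j n, i ≤ t → j ≤ t → (d i : ℤ) * 2 ^ n ≡ d j [ZMOD orderOf γ] → m ∣ n := by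
    intro i j n hi hj hij
    rw [hord] at hij
    exact dvd_of_mul_two_pow_modEq hΔ (hminus i hi) (hminus j hj) (hij.of_mul_right _)
  have hdvd_deg : ∀ i ≤ t,
      m ∣ (minpoly (ZMod 2) ((γ ^ (-(d i : ℤ)) : Fˣ) : F)).natDegree := fun i hi ↦
    hdvd i i _ hi hi ((zpow_neg_pow_two_pow_eq_iff γ _ _ _).1
      ((natDegree_minpoly_zmod_two_dvd_iff _ _).1 dvd_rfl))
  refine ⟨?_, ?_, ?_⟩
  · refine Nat.dvd_antisymm ?_ (hdvd_deg 0 t.zero_le)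
    rw [natDegree_minpoly_zmod_two_dvd_iff, zpow_neg_pow_two_pow_eq_iff, hord]
    obtain ⟨c, hc⟩ := (hplus 0 t.zero_le).dvd
    exact Int.modEq_iff_dvd.2 ⟨c, by push_cast at hc; linear_combination (2 ^ m - 1) * hc⟩
  · intro i hi hit
    obtain ⟨k, hk⟩ := hdvd_deg i hit
    have hdeg : m * k ∣ m * 2 := by
      rw [← hk, natDegree_minpoly_zmod_two_dvd_iff, pow_mul, ← hF, FiniteField.pow_card]
    have hk2 : k ∣ 2 := Nat.dvd_of_mul_dvd_mul_left hm hdeg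
    rcases (Nat.dvd_prime Nat.prime_two).1 hk2 with rfl | rfl
    · have hfix := (natDegree_minpoly_zmod_two_dvd_iff _ _).1 (dvd_of_eq hk)
      rw [mul_one, zpow_neg_pow_two_pow_eq_iff, hord] at hfix
      obtain ⟨c, hc⟩ := (hfix.of_mul_left _).dvd
      obtain ⟨b, hb⟩ := (hplus i hit).dvd
      have := eq_zero_of_dvd_two_mul_mul hm (k := 2 * i)
        (hlt _ (by rw [abs_of_nonneg (by positivity)]; exact_mod_cast Nat.mul_le_mul_left 2 hit))
        ⟨-c - 2 * b - d i, by linear_combination -hc - 2 * hb⟩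
      omega
    · rw [hk, mul_comm]
  · intro i j hi hj hij heq
    obtain ⟨n, hn⟩ := exists_eq_pow_two_pow_of_minpoly_eq heq
    rw [zpow_neg_pow_two_pow_eq_iff] at hn
    have hmn := hdvd i j n hi hj hn
    rw [hord] at hn
    have hn' : -(2 * h * i) * 2 ^ n ≡ -(2 * h * j) [ZMOD 2 ^ m + 1] :=
      (((hplus i hi).mul_right _).symm.trans (hn.of_mul_left _)).trans (hplus j hj)
    rcases two_pow_modEq_one_or_neg_one hmn with hone | hone
    · obtain ⟨c, hc⟩ := ((hone.mul_left (-(2 * h * i))).symm.trans hn').dvd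
      have := eq_zero_of_dvd_two_mul_mul hm (k := (i : ℤ) - j)
        (hlt _ (abs_le.2 ⟨by omega, by omega⟩)) ⟨c, by linear_combination hc⟩
      omega
    · obtain ⟨c, hc⟩ := ((hone.mul_left (-(2 * h * i))).symm.trans hn').dvd
      have := eq_zero_of_dvd_two_mul_mul hm (k := (i : ℤ) + j)
        (hlt _ (abs_le.2 ⟨by omega, by omega⟩)) ⟨-c, by linear_combination -hc⟩
      omega
end

section
/- For any t with 1 ≤ t ≤ (q+1)/(2e), the minimal polynomial of γ^{−d̃_i} over F_p has degree 2m for every 1 ≤ i ≤ t, and the minimal polynomials of γ^{−d̃_i} and γ^{−d̃_j} are distinct for all 1 ≤ i ≠ j ≤ t. -/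
theorem two_mul_dvd_two_mul_iff_of_pow {p m q : ℕ} (hm : 0 < m) (hq : q = p ^ m)
    (x : ℤ) :
    (if p = 2 then (q : ℤ) + 1 else 2 * ((q : ℤ) + 1)) ∣ 2 * x ↔ (q : ℤ) + 1 ∣ x := by
  split_ifs with h2
  · have hcop : IsCoprime ((q : ℤ) + 1) 2 := by
      obtain ⟨c, hc⟩ : 2 ∣ q := by
        rw [hq, h2]
        exact dvd_pow_self 2 hm.ne'
      exact ⟨1, -c, by rw [hc]; push_cast; ring⟩
    exact ⟨fun h => hcop.dvd_of_dvd_mul_left h, fun h => h.mul_left 2⟩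
  · exact mul_dvd_mul_iff_left two_ne_zero

theorem Int.eq_zero_of_dvd_mul_of_abs_lt {h n t : ℕ} (hn : 0 < n)
    (ht : 2 * h.gcd n * t ≤ n) {x : ℤ} (hdvd : (n : ℤ) ∣ x * h) (hx : |x| < 2 * t) : x = 0 := by
  obtain ⟨a, b, hab, ha, hb⟩ := Nat.exists_coprime h n
  set e := h.gcd n
  have he : 0 < e := Nat.gcd_pos_of_pos_right h hn
  have hbx : (b : ℤ) ∣ x := by
    refine (Nat.isCoprime_iff_coprime.mpr hab).symm.dvd_of_dvd_mul_right ?_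
    rw [ha, hb] at hdvd
    push_cast at hdvd
    rw [← mul_assoc] at hdvd
    exact (mul_dvd_mul_iff_right (by exact_mod_cast he.ne')).mp hdvd
  have htb : 2 * t ≤ b := by
    rw [hb] at ht
    exact Nat.le_of_mul_le_mul_right (by linarith) he
  exact Int.eq_zero_of_abs_lt_dvd hbx (hx.trans_le (by exact_mod_cast htb))

/-- If `p ^ k` carries one exponent to another modulo `q - 1`, both congruent to a unit `Δ`,
then `p ^ k` is a power of `q`. -/
theorem dvd_of_dvd_mul_pow_sub {p m Δ a b k : ℕ} (hp : p.Prime)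
    (hΔ : Nat.gcd Δ (p ^ m - 1) = 1)
    (ha : (a : ℤ) ≡ Δ [ZMOD (p : ℤ) ^ m - 1]) (hb : (b : ℤ) ≡ Δ [ZMOD (p : ℤ) ^ m - 1])
    (hab : ((p : ℤ) ^ m - 1) ∣ a * (p : ℤ) ^ k - b) : m ∣ k := by
  have hΔk : ((p : ℤ) ^ m - 1) ∣ Δ * ((p : ℤ) ^ k - 1) := by
    obtain ⟨w, hw⟩ := (hab.add (ha.dvd.mul_right ((p : ℤ) ^ k))).sub hb.dvd
    exact ⟨w, by linear_combination hw⟩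
  have hcast (n : ℕ) : ((p ^ n - 1 : ℕ) : ℤ) = (p : ℤ) ^ n - 1 := by
    rw [Nat.cast_sub (Nat.one_le_pow _ _ hp.pos)]
    simp
  rw [← hcast, ← hcast] at hΔk
  have hdvd : p ^ m - 1 ∣ p ^ k - 1 :=
    (Nat.Coprime.symm hΔ).dvd_of_dvd_mul_left (by exact_mod_cast hΔk)
  have hgcd := Nat.pow_sub_one_gcd_pow_sub_one p m k
  rw [Nat.gcd_eq_left hdvd] at hgcd
  have hpow : p ^ m = p ^ Nat.gcd m k := by
    have := Nat.one_le_pow m p hp.pos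
    have := Nat.one_le_pow (Nat.gcd m k) p hp.pos
    omega
  exact Nat.gcd_eq_left_iff_dvd.mp (Nat.pow_right_injective hp.two_le hpow).symm

theorem FiniteField.exists_pow_eq_of_minpoly_eq {K L : Type*} [Field K] [Fintype K] [Field L]
    [Finite L] [Algebra K L] {x y : L} (hxy : minpoly K x = minpoly K y) :
    ∃ k < Module.finrank K L, x ^ Fintype.card K ^ k = y := by
  obtain ⟨σ, hσ⟩ := minpoly.exists_algEquiv_of_root' (K := K) (x := y) (y := x)
    (Algebra.IsAlgebraic.isAlgebraic x) (by rw [hxy, minpoly.aeval])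
  obtain ⟨k, rfl⟩ := (FiniteField.bijective_frobeniusAlgEquivOfAlgebraic_pow K L).2 σ
  refine ⟨k, k.2, ?_⟩
  simpa [AlgEquiv.coe_pow, FiniteField.coe_frobeniusAlgEquivOfAlgebraic_iterate] using hσ

theorem FiniteField.pow_card_pow_natDegree_minpoly {K L : Type*} [Field K] [Fintype K] [Field L]
    [Finite L] [Algebra K L] (x : L) :
    x ^ Fintype.card K ^ (minpoly K x).natDegree = x := by
  have := Fintype.ofFinite (IntermediateField.adjoin K {x})
  have hx := FiniteField.pow_card (IntermediateField.AdjoinSimple.gen K x)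
  rw [Module.card_eq_pow_finrank (K := K),
    IntermediateField.adjoin.finrank (Algebra.IsIntegral.isIntegral x)] at hx
  simpa using congrArg Subtype.val hx

/-- Lemma 2(2): Let `p` be a prime, `q = p^m`, `F` the field with `q²` elements, `γ` a
generator of `Fˣ`; `h, Δ` positive integers with `h ≢ 0 (mod q+1)`, `gcd(Δ, q-1) = 1`
(and `Δ, h` odd when `p` is odd), and `e = gcd(h, q+1)`.  Let
`d̃_j ≡ s̃_j(q-1) + Δ (mod q²-1)` where `s̃_j ≡ j·h + (Δ-h)·2⁻¹ (mod q+1)` (encoded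
uniformly as `2 s̃_j ≡ 2jh + (Δ-h)` modulo `q+1` if `p = 2` and modulo `2(q+1)` if `p` is
odd).  Then for `1 ≤ t ≤ (q+1)/(2e)`, the minimal polynomial of `γ^{-d̃_i}` over `F_p` has
degree `2m` for `1 ≤ i ≤ t`, and the minimal polynomials of `γ^{-d̃_i}` and `γ^{-d̃_j}` are
distinct for `1 ≤ i ≠ j ≤ t`. -/
theorem stmt_3 (p m : ℕ) (hp : p.Prime) (hm : 0 < m) (q : ℕ) (hq : q = p ^ m)
    (F : Type*) [Field F] [Fintype F] [Algebra (ZMod p) F]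
    (hF : Fintype.card F = q ^ 2)
    (γ : Fˣ) (hγ : ∀ x : Fˣ, x ∈ Subgroup.zpowers γ)
    (h Δ : ℕ) (hh : 0 < h) (hΔpos : 0 < Δ)
    (hhq : ¬ (q + 1) ∣ h) (hΔ : Nat.gcd Δ (q - 1) = 1)
    (hparity : p ≠ 2 → Odd Δ ∧ Odd h)
    (e : ℕ) (he : e = Nat.gcd h (q + 1))
    (t : ℕ) (ht1 : 1 ≤ t) (ht : 2 * e * t ≤ q + 1)
    (d : ℕ → ℕ) (s : ℕ → ℤ)
    (hdpos : ∀ j, 1 ≤ j → j ≤ t → 0 < d j)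
    (hs : ∀ j, 1 ≤ j → j ≤ t →
      2 * s j ≡ 2 * (j : ℤ) * h + ((Δ : ℤ) - h)
        [ZMOD (if p = 2 then (q : ℤ) + 1 else 2 * ((q : ℤ) + 1))])
    (hd : ∀ j, 1 ≤ j → j ≤ t →
      (d j : ℤ) ≡ s j * ((q : ℤ) - 1) + Δ [ZMOD ((q : ℤ) ^ 2 - 1)]) :
    (∀ i, 1 ≤ i → i ≤ t →
      (minpoly (ZMod p) ((γ ^ (-(d i : ℤ)) : Fˣ) : F)).natDegree = 2 * m) ∧
    (∀ i j, 1 ≤ i → i ≤ t → 1 ≤ j → j ≤ t → i ≠ j →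
      minpoly (ZMod p) ((γ ^ (-(d i : ℤ)) : Fˣ) : F) ≠
        minpoly (ZMod p) ((γ ^ (-(d j : ℤ)) : Fˣ) : F)) := by
  have := Fact.mk hp
  have hp1 : 1 ≤ p := hp.one_le
  have hq1 : 1 ≤ q := hq ▸ Nat.one_le_pow m p hp1
  have hq2 : 2 ≤ q := hq ▸ hp.two_le.trans (Nat.le_self_pow hm.ne' p)
  have hqp : (q : ℤ) = (p : ℤ) ^ m := by exact_mod_cast hq
  have hq0 : (q : ℤ) - 1 ≠ 0 := by
    have : (2 : ℤ) ≤ q := by exact_mod_cast hq2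
    linarith
  have hfac : (q : ℤ) ^ 2 - 1 = ((q : ℤ) - 1) * ((q : ℤ) + 1) := by ring
  have hfinrank : Module.finrank (ZMod p) F = 2 * m := by
    have hcard := Module.card_eq_pow_finrank (K := ZMod p) (V := F)
    rw [hF, ZMod.card, hq, ← pow_mul] at hcard
    rw [← Nat.pow_right_injective hp.two_le hcard, mul_comm]
  have horder : (orderOf γ : ℤ) = (q : ℤ) ^ 2 - 1 := by
    rw [orderOf_eq_card_of_forall_mem_zpowers hγ, Nat.card_units, Nat.card_eq_fintype_card, hF,
      Nat.cast_sub (Nat.one_le_pow _ _ hq1)]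
    simp
  have hdΔ : ∀ j, 1 ≤ j → j ≤ t → (d j : ℤ) ≡ Δ [ZMOD (p : ℤ) ^ m - 1] := fun j hj hjt => by
    rw [← hqp]
    have h1 := (hd j hj hjt).dvd
    rw [hfac] at h1
    rw [Int.modEq_iff_dvd]
    obtain ⟨w, hw⟩ := (dvd_of_mul_right_dvd h1).sub
      (Dvd.intro_left (s j) rfl : (q : ℤ) - 1 ∣ s j * (q - 1))
    exact ⟨w, by linear_combination hw⟩
  have hrigid : ∀ i j k : ℕ, 1 ≤ i → i ≤ t → 1 ≤ j → j ≤ t → k < 2 * m →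
      (((γ ^ (-(d i : ℤ)) : Fˣ) : F)) ^ p ^ k = ((γ ^ (-(d j : ℤ)) : Fˣ) : F) →
      k = 0 ∧ i = j := by
    intro i j k hi hit hj hjt hk hγk
    have hexp : (q : ℤ) ^ 2 - 1 ∣ d i * (p : ℤ) ^ k - d j := by
      have : γ ^ (-(d i : ℤ) * (p : ℤ) ^ k) = γ ^ (-(d j : ℤ)) := by
        rw [zpow_mul]
        apply Units.ext
        rw [← hγk]
        norm_cast
      rw [← horder]
      obtain ⟨w, hw⟩ := (zpow_eq_zpow_iff_modEq.mp this).dvd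
      exact ⟨w, by linear_combination hw⟩
    have hmk : m ∣ k := dvd_of_dvd_mul_pow_sub hp (hq ▸ hΔ) (hdΔ i hi hit) (hdΔ j hj hjt) (by
      rw [← hqp]
      rw [hfac] at hexp
      exact dvd_of_mul_right_dvd hexp)
    have hsi := (hs i hi hit).dvd
    have hsj := (hs j hj hjt).dvd
    have hdi := (hd i hi hit).dvd
    have hdj := (hd j hj hjt).dvd
    have hiff := two_mul_dvd_two_mul_iff_of_pow hm hq
    have hcancel : ∀ x : ℤ, (q : ℤ) + 1 ∣ x * h → |x| < 2 * t → x = 0 := fun x hx hxt =>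
      Int.eq_zero_of_dvd_mul_of_abs_lt (n := q + 1) q.succ_pos (he ▸ ht) (by exact_mod_cast hx) hxt
    obtain ⟨c, rfl⟩ := hmk
    obtain rfl | rfl : c = 0 ∨ c = 1 := by
      have : c < 2 := by nlinarith
      omega
    · refine ⟨by simp, ?_⟩
      have hss : (q : ℤ) + 1 ∣ s i - s j := by
        rw [← mul_dvd_mul_iff_left hq0, ← hfac]
        obtain ⟨w, hw⟩ := (hdi.add hexp).sub hdj
        exact ⟨w, by linear_combination hw⟩
      have hij : (q : ℤ) + 1 ∣ ((i : ℤ) - j) * h := by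
        rw [← hiff] at hss ⊢
        obtain ⟨w, hw⟩ := (hss.add hsi).sub hsj
        exact ⟨w, by linear_combination hw⟩
      have := hcancel _ hij (by rw [abs_lt]; omega)
      omega
    · exfalso
      rw [mul_one, ← hqp] at hexp
      have hss : (q : ℤ) + 1 ∣ s i + s j - Δ := by
        have h0 : (q : ℤ) + 1 ∣ q * s i + Δ - s j := by
          rw [← mul_dvd_mul_iff_left hq0, ← hfac]
          obtain ⟨w, hw⟩ := ((hdi.mul_left (q : ℤ)).add hexp).sub hdj
          exact ⟨w, by linear_combination hw⟩
        obtain ⟨w, hw⟩ := (Dvd.intro (s i) rfl : (q : ℤ) + 1 ∣ (q + 1) * s i).sub h0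
        exact ⟨w, by linear_combination hw⟩
      have hij : (q : ℤ) + 1 ∣ ((i : ℤ) + j - 1) * h := by
        rw [← hiff] at hss ⊢
        obtain ⟨w, hw⟩ := (hss.add hsi).add hsj
        exact ⟨w, by linear_combination hw⟩
      have := hcancel _ hij (by rw [abs_lt]; omega)
      omega
  constructor
  · intro i hi hit
    set x : F := ((γ ^ (-(d i : ℤ)) : Fˣ) : F)
    have hint : IsIntegral (ZMod p) x := Algebra.IsIntegral.isIntegral x
    refine le_antisymm (hfinrank ▸ minpoly.natDegree_le x) ?_
    by_contra! hlt
    have hfix := FiniteField.pow_card_pow_natDegree_minpoly (K := ZMod p) x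
    rw [ZMod.card] at hfix
    exact (minpoly.natDegree_pos hint).ne' (hrigid i i _ hi hit hi hit hlt hfix).1
  · intro i j hi hit hj hjt hij hmin
    obtain ⟨k, hk, hkx⟩ := FiniteField.exists_pow_eq_of_minpoly_eq hmin
    rw [ZMod.card] at hkx
    exact hij (hrigid i j k hi hit hj hjt (hfinrank ▸ hk) hkx).2
end

section
/- For any t with 0 ≤ t ≤ (q+1)/(2e), the map a ↦ c(a) from F_q × (F_{q²})^t to the code C^(1) is injective; in particular, the binary cyclic code C^(1) of length q²−1 contains exactly 2^{(2t+1)m} codewords, i.e., has dimension (2t+1)m over F_2. -/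
/-- If `N` is odd and `N ∣ h z` with `2 gcd(h, N) t ≤ N` and `|z| ≤ 2t`, then `z = 0`. -/
lemma eq_zero_of_dvd_mul_of_abs_le {N h t : ℕ} (hN : Odd N) (ht : 2 * Nat.gcd h N * t ≤ N)
    {z : ℤ} (hz : |z| ≤ 2 * t) (hdvd : (N : ℤ) ∣ h * z) : z = 0 := by
  have hNpos : 0 < N := hN.pos
  obtain ⟨e, v, u, he, hco, hv, hu⟩ := Nat.exists_coprime' (Nat.gcd_pos_of_pos_right h hNpos)
  have hge : Nat.gcd h N = e := by
    rw [hv, hu, Nat.gcd_mul_right, hco, one_mul]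
  rw [hge] at ht
  have hudvd : (u : ℤ) ∣ z := by
    have h1 : (e : ℤ) * u ∣ e * (v * z) := by
      have : (e : ℤ) * (v * z) = h * z := by rw [hv]; push_cast; ring
      rw [this]
      have : (e : ℤ) * u = N := by rw [hu]; push_cast; ring
      rwa [this]
    have h2 := Int.dvd_of_mul_dvd_mul_left (by exact_mod_cast he.ne') h1
    exact IsCoprime.dvd_of_dvd_mul_left (Nat.isCoprime_iff_coprime.mpr hco.symm) h2
  have hodd : Odd u := by
    rw [hu] at hN
    exact (Nat.odd_mul.mp hN).1
  have hle : 2 * t ≤ u := by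
    refine Nat.le_of_mul_le_mul_left ?_ he
    calc e * (2 * t) = 2 * e * t := by ring
      _ ≤ N := ht
      _ = e * u := by rw [hu, mul_comm]
  refine Int.eq_zero_of_abs_lt_dvd hudvd ?_
  obtain ⟨w, hw⟩ := hodd
  omega

/-- Two Niho-type exponents differing by a factor `2 ^ l` modulo `2 ^ (2m) - 1` coincide, and the
factor is trivial unless both are the exponent of index `0`. -/
lemma niho_exponent_eq {m : ℕ} (hm : 0 < m) {q : ℕ} (hq : q = 2 ^ m) {h Δ : ℕ}
    (hΔ : Nat.gcd Δ (q - 1) = 1) {t : ℕ} (ht : 2 * Nat.gcd h (q + 1) * t ≤ q + 1)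
    {d : ℕ → ℕ} {s : ℕ → ℤ}
    (hs : ∀ j ≤ t, 2 * s j ≡ 2 * (j : ℤ) * h + Δ [ZMOD ((q : ℤ) + 1)])
    (hd : ∀ j ≤ t, (d j : ℤ) ≡ s j * ((q : ℤ) - 1) + Δ [ZMOD ((q : ℤ) ^ 2 - 1)])
    {i j l : ℕ} (hi : i ≤ t) (hj : j ≤ t) (hl : l < 2 * m)
    (hmod : (d i : ℤ) ≡ 2 ^ l * d j [ZMOD ((q : ℤ) ^ 2 - 1)]) :
    i = j ∧ (l = 0 ∨ l = m ∧ i = 0) := by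
  have hq1 : 1 ≤ q := hq ▸ Nat.one_le_two_pow
  have hfac : (q : ℤ) ^ 2 - 1 = (q - 1) * (q + 1) := by ring
  have hminus : ∀ k ≤ t, (d k : ℤ) ≡ Δ [ZMOD ((q : ℤ) - 1)] := fun k hk ↦ by
    refine ((hd k hk).of_dvd ⟨q + 1, hfac⟩).trans (Int.modEq_iff_dvd.mpr ⟨-s k, ?_⟩)
    ring
  have hplus : ∀ k ≤ t, (d k : ℤ) ≡ -(2 * (k * h)) [ZMOD ((q : ℤ) + 1)] := fun k hk ↦ by
    refine ((hd k hk).of_dvd ⟨q - 1, by rw [hfac, mul_comm]⟩).trans (Int.modEq_iff_dvd.mpr ?_)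
    obtain ⟨w, hw⟩ := (hs k hk).dvd
    exact ⟨-w - s k, by linear_combination -hw⟩
  have hml : m ∣ l := by
    have h1 : (q : ℤ) - 1 ∣ Δ * (2 ^ l - 1) := by
      have h2 := (((hminus i hi).symm.trans (hmod.of_dvd ⟨q + 1, hfac⟩)).trans
        ((hminus j hj).mul_left (2 ^ l))).dvd
      convert h2 using 1
      ring
    have h3 : q - 1 ∣ Δ * (2 ^ l - 1) := by
      zify [hq1, Nat.one_le_two_pow (n := l)]
      exact h1
    have h4 : 2 ^ m - 1 ∣ 2 ^ l - 1 := hq ▸ (Nat.Coprime.symm hΔ).dvd_of_dvd_mul_left h3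
    have h5 := Nat.gcd_eq_left h4
    rw [Nat.pow_sub_one_gcd_pow_sub_one] at h5
    refine Nat.gcd_eq_left_iff_dvd.mp (Nat.pow_right_injective le_rfl ?_)
    have := Nat.one_le_two_pow (n := m)
    have := Nat.one_le_two_pow (n := m.gcd l)
    dsimp only
    omega
  have hodd : Odd (q + 1) := by
    rw [hq]; exact (Even.pow_of_ne_zero even_two hm.ne').add_one
  have hco : IsCoprime ((q : ℤ) + 1) 2 := by
    exact_mod_cast Nat.isCoprime_iff_coprime.mpr (Nat.coprime_two_right.mpr hodd)
  have hkey : (q : ℤ) + 1 ∣ 2 ^ l * (j * h) - i * h := by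
    refine hco.dvd_of_dvd_mul_left ?_
    have h1 := (((hplus i hi).symm.trans (hmod.of_dvd ⟨q - 1, by rw [hfac, mul_comm]⟩)).trans
      ((hplus j hj).mul_left (2 ^ l))).dvd
    rw [show (2 : ℤ) * (2 ^ l * (j * h) - i * h) =
      -(2 ^ l * -(2 * (j * h)) - -(2 * (i * h))) by ring]
    exact h1.neg_right
  have hjt : (j : ℤ) ≤ t := by exact_mod_cast hj
  have hit : (i : ℤ) ≤ t := by exact_mod_cast hi
  obtain ⟨c, rfl⟩ := hml
  have hc : c < 2 := by nlinarith
  interval_cases c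
  · have := eq_zero_of_dvd_mul_of_abs_le hodd ht (z := j - i)
      (by rw [abs_le]; omega) (by push_cast; convert hkey using 1; ring)
    exact ⟨by omega, Or.inl (by simp)⟩
  · have hdvd : (q : ℤ) + 1 ∣ h * (i + j) := by
      have h2 : (h : ℤ) * (i + j) = (q + 1) * (j * h) - (2 ^ (m * 1) * (j * h) - i * h) := by
        rw [hq]; push_cast; ring
      rw [h2]
      exact dvd_sub (dvd_mul_right _ _) hkey
    have := eq_zero_of_dvd_mul_of_abs_le hodd ht (z := i + j)
      (by rw [abs_le]; omega) (by exact_mod_cast hdvd)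
    exact ⟨by omega, Or.inr ⟨by simp, by omega⟩⟩

/-- The exponents `2 ^ k d_j` are pairwise incongruent modulo `q ^ 2 - 1`, where `k` ranges over
`m` values for `j = 0` and over `2m` values for `j > 0`. -/
lemma niho_exponent_injective {m : ℕ} (hm : 0 < m) {q : ℕ} (hq : q = 2 ^ m) {h Δ : ℕ}
    (hΔ : Nat.gcd Δ (q - 1) = 1) {t : ℕ} (ht : 2 * Nat.gcd h (q + 1) * t ≤ q + 1)
    {d : ℕ → ℕ} {s : ℕ → ℤ}
    (hs : ∀ j ≤ t, 2 * s j ≡ 2 * (j : ℤ) * h + Δ [ZMOD ((q : ℤ) + 1)])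
    (hd : ∀ j ≤ t, (d j : ℤ) ≡ s j * ((q : ℤ) - 1) + Δ [ZMOD ((q : ℤ) ^ 2 - 1)])
    {i j k l : ℕ} (hi : i ≤ t) (hj : j ≤ t) (hk : k < 2 * m) (hl : l < 2 * m)
    (hk0 : i = 0 → k < m) (hl0 : j = 0 → l < m)
    (hmod : 2 ^ k * d i ≡ 2 ^ l * d j [MOD q ^ 2 - 1]) : i = j ∧ k = l := by
  wlog hkl : k ≤ l generalizing i j k l
  · have := this hj hi hl hk hl0 hk0 hmod.symm (by omega)
    omega
  obtain ⟨r, rfl⟩ := Nat.exists_eq_add_of_le hkl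
  have hq2 : 1 ≤ q ^ 2 := Nat.one_le_pow _ _ (hq ▸ by positivity)
  have hmod' : d i ≡ 2 ^ r * d j [MOD q ^ 2 - 1] := by
    refine Nat.ModEq.cancel_left_of_coprime (c := 2 ^ k) ?_ (by rwa [← mul_assoc, ← pow_add])
    refine Nat.Coprime.pow_right k (Nat.coprime_two_right.mpr ?_)
    refine Nat.Even.sub_odd hq2 ?_ odd_one
    rw [hq]
    exact (even_two.pow_of_ne_zero hm.ne').pow_of_ne_zero two_ne_zero
  have hmodz := Int.natCast_modEq_iff.mpr hmod'
  push_cast [Nat.cast_sub hq2] at hmodz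
  have := niho_exponent_eq hm hq hΔ ht hs hd hi hj (by omega) hmodz
  omega

/-- A linear combination of pairwise distinct power functions vanishing on a cyclic group of units
of a domain is trivial. -/
lemma eq_zero_of_forall_sum_mul_pow_eq_zero {R ι : Type*} [CommRing R] [IsDomain R] [Fintype ι]
    (γ : Rˣ) (n : ι → ℕ) (hn : ∀ a b, n a ≡ n b [MOD orderOf γ] → a = b)
    (b : ι → R) (hb : ∀ x : Rˣ, ∑ k, b k * (x : R) ^ n k = 0) (k : ι) : b k = 0 := by
  let f : ι → (Rˣ →* R) := fun k ↦ (Units.coeHom R).comp (powMonoidHom (n k))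
  have hf : Function.Injective f := fun a b hab ↦ hn a b <| by
    rw [← pow_eq_pow_iff_modEq]
    have := DFunLike.congr_fun hab γ
    exact Units.ext this
  have hli := (linearIndependent_monoidHom Rˣ R).comp f hf
  rw [Fintype.linearIndependent_iff] at hli
  refine hli b (funext fun x ↦ ?_) k
  simpa [f] using hb x


/-- Theorem 1(i), dimension part: with `p = 2`, `q = 2^m`, `K` the field with `q` elements,
`F` the field with `q²` elements, `γ` a generator of `Fˣ`, and Niho-type exponents
`d_0, …, d_t` as in the paper (so that `γ^{d_0}` lies in the subfield `K`, with preimage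
`g₀`), the codeword map `a ↦ c(a)` of the binary cyclic code `C⁽¹⁾`,
`c(a)_i = Tr_{q/2}(a₀ γ^{d₀ i}) + Tr_{q²/2}(∑_{j=1}^t a_j γ^{d_j i})`, is injective on
`F_q × (F_{q²})^t`; in particular the code has exactly `2^{(2t+1)m}` codewords, i.e.
dimension `(2t+1)m` over `F_2`. -/
theorem stmt_4 (m : ℕ) (hm : 0 < m) (q : ℕ) (hq : q = 2 ^ m)
    (K F : Type*) [Field K] [Fintype K] [Field F] [Fintype F]
    [Algebra (ZMod 2) K] [Algebra (ZMod 2) F] [Algebra K F]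
    [IsScalarTower (ZMod 2) K F]
    (hK : Fintype.card K = q) (hF : Fintype.card F = q ^ 2)
    (γ : Fˣ) (hγ : ∀ x : Fˣ, x ∈ Subgroup.zpowers γ)
    (h Δ : ℕ) (hh : 0 < h) (hΔpos : 0 < Δ)
    (hhq : ¬ (q + 1) ∣ h) (hΔ : Nat.gcd Δ (q - 1) = 1)
    (e : ℕ) (he : e = Nat.gcd h (q + 1))
    (t : ℕ) (ht : 2 * e * t ≤ q + 1)
    (d : ℕ → ℕ) (s : ℕ → ℤ)
    (hdpos : ∀ j ≤ t, 0 < d j)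
    (hs : ∀ j ≤ t, 2 * s j ≡ 2 * (j : ℤ) * h + Δ [ZMOD ((q : ℤ) + 1)])
    (hd : ∀ j ≤ t, (d j : ℤ) ≡ s j * ((q : ℤ) - 1) + Δ [ZMOD ((q : ℤ) ^ 2 - 1)])
    (g₀ : K) (hg₀ : algebraMap K F g₀ = (γ : F) ^ d 0)
    (c : K × (Fin t → F) → Fin (q ^ 2 - 1) → ZMod 2)
    (hc : ∀ a i, c a i =
      Algebra.trace (ZMod 2) K (a.1 * g₀ ^ (i : ℕ)) +
      Algebra.trace (ZMod 2) F
        (∑ j : Fin t, a.2 j * (γ : F) ^ (d ((j : ℕ) + 1) * (i : ℕ)))) :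
    Function.Injective c ∧ Nat.card (Set.range c) = 2 ^ ((2 * t + 1) * m) := by
  subst he
  have hq2 : 1 ≤ q ^ 2 := Nat.one_le_pow _ _ (hq ▸ by positivity)
  have hord : orderOf γ = q ^ 2 - 1 := by
    rw [orderOf_eq_card_of_forall_mem_zpowers hγ, Nat.card_units, Nat.card_eq_fintype_card, hF]
  have hfinK : Module.finrank (ZMod 2) K = m := by
    have := Module.card_eq_pow_finrank (K := ZMod 2) (V := K)
    rw [hK, hq, ZMod.card] at this
    exact (Nat.pow_right_injective le_rfl this).symm
  have hfinF : Module.finrank (ZMod 2) F = 2 * m := by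
    have := Module.card_eq_pow_finrank (K := ZMod 2) (V := F)
    rw [hF, hq, ZMod.card, ← pow_mul] at this
    rw [mul_comm]
    exact (Nat.pow_right_injective le_rfl this).symm
  have : CharP F 2 := charP_of_injective_algebraMap (algebraMap (ZMod 2) F).injective 2
  have hsub : ∀ a b i, c (a - b) i = c a i - c b i := fun a b i ↦ by
    simp only [hc, Prod.fst_sub, Prod.snd_sub, Pi.sub_apply, sub_mul, map_sub,
      Finset.sum_sub_distrib]
    ring
  have hker : ∀ a, (∀ i, c a i = 0) → a = 0 := fun a ha ↦ by
    let n : Fin m ⊕ Fin t × Fin (2 * m) → ℕ :=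
      Sum.elim (fun k ↦ 2 ^ (k : ℕ) * d 0) (fun p ↦ 2 ^ (p.2 : ℕ) * d ((p.1 : ℕ) + 1))
    let b : Fin m ⊕ Fin t × Fin (2 * m) → F :=
      Sum.elim (fun k ↦ algebraMap K F a.1 ^ 2 ^ (k : ℕ)) (fun p ↦ a.2 p.1 ^ 2 ^ (p.2 : ℕ))
    have hn : ∀ x y, n x ≡ n y [MOD orderOf γ] → x = y := by
      rw [hord]
      rintro (k | ⟨i, k⟩) (l | ⟨j, l⟩) hxy
      · have := niho_exponent_injective hm hq hΔ ht hs hd (Nat.zero_le t) (Nat.zero_le t)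
          (by omega) (by omega) (fun _ ↦ k.2) (fun _ ↦ l.2) hxy
        rw [Fin.ext this.2]
      · have := niho_exponent_injective hm hq hΔ ht hs hd (Nat.zero_le t) j.2
          (by omega) l.2 (fun _ ↦ k.2) (by simp) hxy
        omega
      · have := niho_exponent_injective hm hq hΔ ht hs hd i.2 (Nat.zero_le t)
          k.2 (by omega) (by simp) (fun _ ↦ l.2) hxy
        omega
      · have := niho_exponent_injective hm hq hΔ ht hs hd i.2 j.2 k.2 l.2 (by simp) (by simp) hxy
        rw [Fin.ext (Nat.succ_injective this.1), Fin.ext this.2]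
    have hb : ∀ x : Fˣ, ∑ k, b k * (x : F) ^ n k = 0 := fun x ↦ by
      obtain ⟨i, hi, rfl⟩ : ∃ i < orderOf γ, γ ^ i = x := by
        obtain ⟨i, hi⟩ := (isOfFinOrder_of_finite γ).mem_powers_iff_mem_zpowers.mpr (hγ x)
        exact ⟨i % orderOf γ, Nat.mod_lt _ (orderOf_pos γ), by rw [pow_mod_orderOf]; exact hi⟩
      rw [hord] at hi
      have h0 := congrArg (algebraMap (ZMod 2) F) (ha ⟨i, hi⟩)
      rw [hc, map_add, IsScalarTower.algebraMap_apply (ZMod 2) K F,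
        FiniteField.algebraMap_trace_eq_sum_pow, FiniteField.algebraMap_trace_eq_sum_pow,
        hfinK, hfinF, Nat.card_eq_fintype_card, ZMod.card, map_zero, map_sum,
        Finset.sum_range, Finset.sum_range] at h0
      rw [← h0, Fintype.sum_sum_type, Fintype.sum_prod_type_right]
      congr 1
      · refine Finset.sum_congr rfl fun k _ ↦ ?_
        simp only [b, n, Sum.elim_inl, map_pow, map_mul, hg₀, mul_pow, Units.val_pow_eq_pow_val]
        ring
      · refine Finset.sum_congr rfl fun k _ ↦ ?_
        rw [sum_pow_char_pow]
        refine Finset.sum_congr rfl fun j _ ↦ ?_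
        simp only [b, n, Sum.elim_inr, mul_pow, Units.val_pow_eq_pow_val]
        ring
    have hzero := eq_zero_of_forall_sum_mul_pow_eq_zero γ n hn b hb
    refine Prod.ext ?_ (funext fun j ↦ ?_)
    · simpa [b] using hzero (Sum.inl ⟨0, hm⟩)
    · simpa [b] using hzero (Sum.inr (j, ⟨0, by omega⟩))
  have hinj : Function.Injective c := fun a b hab ↦ sub_eq_zero.mp <| hker _ fun i ↦ by
    rw [hsub, hab, sub_self]
  refine ⟨hinj, ?_⟩
  rw [Nat.card_range_of_injective hinj, Nat.card_eq_fintype_card, Fintype.card_prod,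
    Fintype.card_fun, Fintype.card_fin, hK, hF, hq]
  ring
end

section
/- For any t with 0 ≤ t ≤ (q+1)/(2e) and any nonzero a = (a_0, a_1, …, a_t) ∈ F_q × (F_{q²})^t, the Hamming weight of the codeword c(a) of C^(1) equals (q² − (je−1)q)/2 for some integer j with 0 ≤ j ≤ 2t. In particular, C^(1) has at most 2t+1 distinct nonzero weights. -/
/-- A nonzero multiple of the absolute trace of a binary field is nonzero on half of the field. -/
lemma two_mul_card_trace_mul_ne_zero {K : Type*} [Field K] [Fintype K] [Algebra (ZMod 2) K]
    {b : K} (hb : b ≠ 0) :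
    2 * Nat.card {y : Kˣ // Algebra.trace (ZMod 2) K (b * y) ≠ 0} = Nat.card K := by
  classical
  let f : K →+ ZMod 2 :=
    (Algebra.trace (ZMod 2) K).toAddMonoidHom.comp (AddMonoidHom.mulLeft b)
  have hf : ∀ x, f x = Algebra.trace (ZMod 2) K (b * x) := fun _ ↦ rfl
  have hsurj : Function.Surjective f := fun z ↦ by
    obtain ⟨x, hx⟩ := Algebra.trace_surjective (ZMod 2) K z
    exact ⟨b⁻¹ * x, by rw [hf, mul_inv_cancel_left₀ hb, hx]⟩
  have hfib : Finset.card {x | f x = 0} = Finset.card {x | f x = 1} :=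
    AddMonoidHom.card_fiber_eq_of_mem_range f (hsurj 0) (hsurj 1)
  have hne : ∀ z : ZMod 2, z ≠ 0 ↔ z = 1 := by decide
  have hsum : Finset.card {x | f x = 0} + Finset.card {x | ¬ f x = 0} = Nat.card K := by
    rw [Finset.card_filter_add_card_filter_not, Finset.card_univ, Nat.card_eq_fintype_card]
  have hunits : Nat.card {y : Kˣ // Algebra.trace (ZMod 2) K (b * y) ≠ 0} =
      Finset.card {x | f x = 1} := by
    rw [← Fintype.card_subtype, ← Nat.card_eq_fintype_card]
    refine Nat.card_congr
      { toFun := fun y ↦ ⟨y.1, (hne _).1 y.2⟩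
        invFun := fun x ↦ ⟨Units.mk0 x.1 fun h0 ↦ ?_, (hne _).2 x.2⟩
        left_inv := fun y ↦ by ext; rfl
        right_inv := fun x ↦ by ext; rfl }
    have := x.2
    rw [h0, map_zero] at this
    exact zero_ne_one this
  simp only [hne] at hsum
  omega

/-- Counting solutions of a condition on `x ^ n` in a finite cyclic group. -/
lemma IsCyclic.card_subtype_pow {G : Type*} [CommGroup G] [IsCyclic G] [Finite G] (n : ℕ)
    (p : G → Prop) :
    Nat.card {x : G // p (x ^ n)} =
      (Nat.card G).gcd n * Nat.card {u : (powMonoidHom n : G →* G).range // p u} := by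
  classical
  let f : {x : G // p (x ^ n)} → {u : (powMonoidHom n : G →* G).range // p u} :=
    fun x ↦ ⟨⟨x.1 ^ n, x.1, rfl⟩, x.2⟩
  have hfib : ∀ u, Nat.card {x // f x = u} = (Nat.card G).gcd n := by
    rintro ⟨⟨_, z, rfl⟩, hz⟩
    rw [← IsCyclic.card_powMonoidHom_ker]
    refine Nat.card_congr
      { toFun := fun x ↦ ⟨x.1.1 * z⁻¹, ?_⟩
        invFun := fun k ↦ ⟨⟨k.1 * z, ?_⟩, ?_⟩
        left_inv := fun x ↦ by ext; simp
        right_inv := fun x ↦ by ext; simp }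
    · have : x.1.1 ^ n = z ^ n := congrArg (fun u ↦ (u.1.1 : G)) x.2
      simp [MonoidHom.mem_ker, mul_pow, this]
    · have : k.1 ^ n = 1 := k.2
      simpa [mul_pow, this] using hz
    · have : k.1 ^ n = 1 := k.2
      simp [f, mul_pow, this]
  have := Fintype.ofFinite {u : (powMonoidHom n : G →* G).range // p u}
  rw [← Nat.card_congr (Equiv.sigmaFiberEquiv f), Nat.card_sigma]
  simp only [hfib, Finset.sum_const, Finset.card_univ, smul_eq_mul]
  rw [mul_comm, Nat.card_eq_fintype_card (α := {u : (powMonoidHom n : G →* G).range // p u})]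

/-- If `T` is homogeneous of degree `r` under a subgroup of scalars, with `r` prime to the order
of the scalar group, then the number of `x` with `Tr (T x) ≠ 0` is determined by the number
of nonzeros of `T`. -/
lemma two_mul_card_units_mul_card_trace_ne_zero {G K : Type*} [Group G] [Finite G]
    [Field K] [Fintype K] [Algebra (ZMod 2) K] (ι : Kˣ →* G) {r : ℕ}
    (hr : (Nat.card Kˣ).Coprime r) (T : G → K)
    (hT : ∀ x y, T (x * ι y) = T x * ((y ^ r : Kˣ) : K)) :
    2 * Nat.card Kˣ * Nat.card {x // Algebra.trace (ZMod 2) K (T x) ≠ 0} =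
      Nat.card K * Nat.card {x // T x ≠ 0} := by
  classical
  have := Fintype.ofFinite G
  have key : ∀ x, 2 * Nat.card {y : Kˣ // Algebra.trace (ZMod 2) K (T (x * ι y)) ≠ 0} =
      if T x ≠ 0 then Nat.card K else 0 := by
    intro x
    split_ifs with hx
    · rw [← two_mul_card_trace_mul_ne_zero hx]
      congr 1
      exact Nat.card_congr ((powCoprime hr).subtypeEquiv fun y ↦ by simp [hT])
    · simp only [not_not] at hx
      simp [hT, hx]
  have hfst : ∀ y : Kˣ, Finset.card {x | Algebra.trace (ZMod 2) K (T (x * ι y)) ≠ 0} =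
      Nat.card {x // Algebra.trace (ZMod 2) K (T x) ≠ 0} := by
    intro y
    rw [← Fintype.card_subtype, ← Nat.card_eq_fintype_card]
    exact Nat.card_congr ((Equiv.mulRight (ι y)).subtypeEquiv fun x ↦ by simp)
  have hdc := Finset.sum_card_bipartiteAbove_eq_sum_card_bipartiteBelow
    (s := (Finset.univ : Finset G)) (t := (Finset.univ : Finset Kˣ))
    (fun x y ↦ Algebra.trace (ZMod 2) K (T (x * ι y)) ≠ 0)
  simp only [Finset.bipartiteAbove, Finset.bipartiteBelow, hfst, Finset.sum_const,
    Finset.card_univ, smul_eq_mul] at hdc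
  rw [mul_assoc, Nat.card_eq_fintype_card (α := Kˣ), ← hdc, Finset.mul_sum]
  rw [Finset.sum_congr rfl fun x _ ↦ by
    rw [← Fintype.card_subtype, ← Nat.card_eq_fintype_card, key x]]
  rw [← Finset.sum_filter, Finset.sum_const, ← Fintype.card_subtype, Nat.card_eq_fintype_card,
    smul_eq_mul, mul_comm, Nat.card_eq_fintype_card]

open Polynomial in
/-- A nonzero Laurent polynomial with terms in degrees `-t, …, t` has at most `2t` roots. -/
lemma card_laurent_roots_le {F : Type*} [Field F] [Finite F] {t : ℕ} (a₀ : F) (a b : Fin t → F)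
    (hne : a₀ ≠ 0 ∨ a ≠ 0) (S : Type*) [Finite S] (v : S → F) (hv : Function.Injective v)
    (hroot : ∀ u, a₀ * v u ^ t + ∑ j : Fin t, (a j * v u ^ (t + (j + 1)) +
      b j * v u ^ (t - (j + 1))) = 0) :
    Nat.card S ≤ 2 * t := by
  classical
  let P : F[X] := C a₀ * X ^ t + ∑ j : Fin t, (C (a j) * X ^ (t + ((j : ℕ) + 1)) +
      C (b j) * X ^ (t - ((j : ℕ) + 1)))
  have hdeg : P.natDegree ≤ 2 * t := by
    refine natDegree_add_le_of_degree_le ((natDegree_C_mul_X_pow_le _ _).trans (by omega))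
      (natDegree_sum_le_of_forall_le _ _ fun j _ ↦ natDegree_add_le_of_degree_le
        ((natDegree_C_mul_X_pow_le _ _).trans (by omega))
        ((natDegree_C_mul_X_pow_le _ _).trans (by omega)))
  have hP : P ≠ 0 := by
    intro h0
    rcases hne with h | h
    · refine h ?_
      have := congrArg (fun p ↦ p.coeff t) h0
      simpa only [P, coeff_add, finsetSum_coeff, coeff_C_mul_X_pow, coeff_zero, if_pos,
        Finset.sum_eq_zero fun (j : Fin t) _ ↦ (show
          ((if t = t + ((j : ℕ) + 1) then a j else 0) +
            if t = t - ((j : ℕ) + 1) then b j else 0) = 0 by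
          rw [if_neg (by omega), if_neg (by omega), add_zero]), add_zero] using this
    · refine h (funext fun i ↦ ?_)
      have := congrArg (fun p ↦ p.coeff (t + ((i : ℕ) + 1))) h0
      simp only [P, coeff_add, finsetSum_coeff, coeff_C_mul_X_pow, coeff_zero] at this
      rw [if_neg (by omega), zero_add, Finset.sum_eq_single i, if_pos rfl, if_neg (by omega),
        add_zero] at this
      · exact this
      · intro j _ hj
        have : (j : ℕ) ≠ i := fun h ↦ hj (Fin.ext h)
        rw [if_neg (by omega), if_neg (by omega), add_zero]
      · simp
  have hmem : ∀ u, v u ∈ P.roots.toFinset := fun u ↦ by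
    rw [Multiset.mem_toFinset, mem_roots hP, IsRoot, ← hroot u]
    simp [P, eval_finsetSum]
  calc Nat.card S ≤ Nat.card P.roots.toFinset :=
        Nat.card_le_card_of_injective (fun u ↦ (⟨v u, hmem u⟩ : P.roots.toFinset))
          fun _ _ h ↦ hv (congrArg Subtype.val h)
    _ = P.roots.toFinset.card := by rw [Nat.card_eq_fintype_card, Fintype.card_coe]
    _ ≤ P.roots.card := Multiset.toFinset_card_le _
    _ ≤ 2 * t := (card_roots' P).trans hdeg


/-- Theorem 1(i), weight part: with the setup of the binary code `C⁽¹⁾` (see the paper),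
for every nonzero message `a = (a₀, a₁, …, a_t)` the Hamming weight of the codeword `c(a)`
equals `(q² - (je-1)q)/2` for some `0 ≤ j ≤ 2t` (stated as `2·wt(c(a)) = q² - (je-1)q` over
`ℤ`); in particular `C⁽¹⁾` has at most `2t+1` distinct nonzero weights. -/
theorem stmt_5 (m : ℕ) (hm : 0 < m) (q : ℕ) (hq : q = 2 ^ m)
    (K F : Type*) [Field K] [Fintype K] [Field F] [Fintype F]
    [Algebra (ZMod 2) K] [Algebra (ZMod 2) F] [Algebra K F]
    [IsScalarTower (ZMod 2) K F]
    (hK : Fintype.card K = q) (hF : Fintype.card F = q ^ 2)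
    (γ : Fˣ) (hγ : ∀ x : Fˣ, x ∈ Subgroup.zpowers γ)
    (h Δ : ℕ) (hh : 0 < h) (hΔpos : 0 < Δ)
    (hhq : ¬ (q + 1) ∣ h) (hΔ : Nat.gcd Δ (q - 1) = 1)
    (e : ℕ) (he : e = Nat.gcd h (q + 1))
    (t : ℕ) (ht : 2 * e * t ≤ q + 1)
    (d : ℕ → ℕ) (s : ℕ → ℤ)
    (hdpos : ∀ j ≤ t, 0 < d j)
    (hs : ∀ j ≤ t, 2 * s j ≡ 2 * (j : ℤ) * h + Δ [ZMOD ((q : ℤ) + 1)])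
    (hd : ∀ j ≤ t, (d j : ℤ) ≡ s j * ((q : ℤ) - 1) + Δ [ZMOD ((q : ℤ) ^ 2 - 1)])
    (g₀ : K) (hg₀ : algebraMap K F g₀ = (γ : F) ^ d 0)
    (c : K × (Fin t → F) → Fin (q ^ 2 - 1) → ZMod 2)
    (hc : ∀ a i, c a i =
      Algebra.trace (ZMod 2) K (a.1 * g₀ ^ (i : ℕ)) +
      Algebra.trace (ZMod 2) F
        (∑ j : Fin t, a.2 j * (γ : F) ^ (d ((j : ℕ) + 1) * (i : ℕ)))) :
    (∀ a : K × (Fin t → F), a ≠ 0 → ∃ j : ℕ, j ≤ 2 * t ∧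
      (2 * hammingNorm (c a) : ℤ) = (q : ℤ) ^ 2 - ((j : ℤ) * e - 1) * q) ∧
    {w : ℕ | ∃ a : K × (Fin t → F), a ≠ 0 ∧ hammingNorm (c a) = w}.ncard ≤ 2 * t + 1 := by
  classical
  have hq2 : 2 ≤ q := hq ▸ Nat.le_self_pow hm.ne' 2
  have hqZ : (1 : ℤ) < q := by exact_mod_cast hq2
  obtain ⟨r, hr⟩ : ∃ r : ℤ, (q : ℤ) = 2 * r := by
    obtain ⟨k, rfl⟩ := Nat.exists_eq_succ_of_ne_zero hm.ne'
    exact ⟨2 ^ k, by rw [hq, pow_succ']; push_cast; rfl⟩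
  have hfac : q ^ 2 - 1 = (q + 1) * (q - 1) := by simpa using Nat.sq_sub_sq q 1
  have hKu : Nat.card Kˣ = q - 1 := by rw [Nat.card_units, Nat.card_eq_fintype_card, hK]
  have hFu : Nat.card Fˣ = q ^ 2 - 1 := by rw [Nat.card_units, Nat.card_eq_fintype_card, hF]
  have hKcast : ((q - 1 : ℕ) : ℤ) = q - 1 := by push_cast [show 1 ≤ q by omega]; rfl
  have hFcast : ((q ^ 2 - 1 : ℕ) : ℤ) = q ^ 2 - 1 := by
    push_cast [show 1 ≤ q ^ 2 from Nat.one_le_pow _ _ (by omega)]; rfl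
  have hch : CharP F 2 := charP_of_injective_algebraMap (algebraMap (ZMod 2) F).injective 2
  have hfin : Module.finrank K F = 2 := by
    have := Module.card_eq_pow_finrank (K := K) (V := F)
    rw [hF, hK] at this
    exact (Nat.pow_right_injective hq2 this).symm
  have hpowK : ∀ j ≤ t, ∀ y : Kˣ, y ^ d j = y ^ Δ := by
    intro j hj y
    refine pow_eq_pow_of_modEq (n := q - 1) ?_ (hKu ▸ pow_card_eq_one')
    rw [← Int.natCast_modEq_iff, hKcast]
    have h1 := (hd j hj).of_dvd (show (q : ℤ) - 1 ∣ q ^ 2 - 1 from ⟨q + 1, by ring⟩)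
    exact h1.trans (by simp [Int.modEq_iff_dvd])
  have hpowF : ∀ k l : ℕ, (k : ℤ) ≡ l [ZMOD (q : ℤ) ^ 2 - 1] → ∀ x : Fˣ, x ^ k = x ^ l := by
    intro k l hkl x
    refine pow_eq_pow_of_modEq (n := q ^ 2 - 1) ?_ (hFu ▸ pow_card_eq_one')
    rwa [← Int.natCast_modEq_iff, hFcast]
  have hd₀ : (q : ℤ) * d 0 ≡ d 0 [ZMOD (q : ℤ) ^ 2 - 1] := by
    obtain ⟨k, hk⟩ := (hd 0 t.zero_le).dvd
    obtain ⟨l, hl⟩ := (hs 0 t.zero_le).dvd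
    refine Int.modEq_iff_dvd.2 ⟨(q - 1) * k - (s 0 + l), ?_⟩
    push_cast at hl
    linear_combination ((q : ℤ) - 1) * hk + (1 - (q : ℤ)) * hl
  have hdj : ∀ j ≤ t, (d j : ℤ) ≡ d 0 + j * (h * (q - 1)) [ZMOD (q : ℤ) ^ 2 - 1] := by
    intro j hj
    obtain ⟨k, hk⟩ := (hd j hj).dvd
    obtain ⟨k₀, hk₀⟩ := (hd 0 t.zero_le).dvd
    obtain ⟨l, hl⟩ := (hs j hj).dvd
    obtain ⟨l₀, hl₀⟩ := (hs 0 t.zero_le).dvd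
    push_cast at hl₀
    have hdiv : (q : ℤ) + 1 ∣ s 0 + j * h - s j := by
      refine ⟨s 0 + j * h - s j - r * (l - l₀), ?_⟩
      linear_combination (-r) * hl + r * hl₀ - (s 0 + j * h - s j) * hr
    obtain ⟨w, hw⟩ := hdiv
    refine Int.modEq_iff_dvd.2 ⟨w + k - k₀, ?_⟩
    linear_combination hk - hk₀ + (q - 1) * hw
  have hx₁ : ∀ j ≤ t, ∀ x : Fˣ, x ^ d j = x ^ d 0 * (x ^ (h * (q - 1))) ^ j := by
    intro j hj x
    rw [← pow_mul, ← pow_add]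
    refine hpowF _ _ ?_ x
    push_cast [hKcast]
    exact (hdj j hj).trans (by ring_nf; rfl)
  have hx₂ : ∀ j ≤ t, ∀ x : Fˣ, (x ^ d j) ^ q * (x ^ (h * (q - 1))) ^ j = x ^ d 0 := by
    intro j hj x
    rw [← pow_mul, ← pow_mul, ← pow_add]
    refine hpowF _ _ ?_ x
    push_cast [hKcast]
    have h1 := ((hdj j hj).mul_right (q : ℤ)).add_right (h * ((q : ℤ) - 1) * j)
    refine h1.trans ((Int.ModEq.trans ?_ hd₀))
    exact Int.modEq_iff_dvd.2 ⟨-(j * h), by ring⟩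
  have hγpow : ∀ x : Fˣ, ∃ i : ℕ, γ ^ i = x := fun x ↦
    (mem_powers_iff_mem_zpowers.2 (hγ x))
  have hγord : orderOf γ = q ^ 2 - 1 := hFu ▸ orderOf_eq_card_of_forall_mem_zpowers hγ
  have hinj := (algebraMap K F).injective
  have hρ : ∀ x : Fˣ, ∃ k : K, algebraMap K F k = (x : F) ^ d 0 := by
    intro x
    obtain ⟨i, rfl⟩ := hγpow x
    exact ⟨g₀ ^ i, by rw [map_pow, hg₀, Units.val_pow_eq_pow_val, pow_right_comm]⟩
  choose ρ hρ using hρ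
  have hweight : ∀ a : K × (Fin t → F), a ≠ 0 → ∃ j : ℕ, j ≤ 2 * t ∧
      (2 * hammingNorm (c a) : ℤ) = (q : ℤ) ^ 2 - ((j : ℤ) * e - 1) * q := by
    intro a ha
    let T : Fˣ → K := fun x ↦ a.1 * ρ x +
      Algebra.trace K F (∑ j : Fin t, a.2 j * (x : F) ^ d ((j : ℕ) + 1))
    have hT : ∀ x y, T (x * Units.map (algebraMap K F : K →* F) y) =
        T x * ((y ^ Δ : Kˣ) : K) := by
      intro x y
      have hy : ∀ j ≤ t, algebraMap K F (y : K) ^ d j = algebraMap K F ((y ^ Δ : Kˣ) : K) := by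
        intro j hj
        rw [← map_pow, ← Units.val_pow_eq_pow_val, hpowK j hj]
      have h1 : ρ (x * Units.map (algebraMap K F : K →* F) y) = ρ x * ((y ^ Δ : Kˣ) : K) := by
        apply hinj
        rw [map_mul, hρ, hρ, ← hy 0 t.zero_le, ← mul_pow]
        rfl
      have h2 : ∑ j : Fin t, a.2 j *
          ((x * Units.map (algebraMap K F : K →* F) y : Fˣ) : F) ^ d ((j : ℕ) + 1) =
          ((y ^ Δ : Kˣ) : K) • ∑ j : Fin t, a.2 j * (x : F) ^ d ((j : ℕ) + 1) := by
        rw [Finset.smul_sum]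
        refine Finset.sum_congr rfl fun j _ ↦ ?_
        rw [Algebra.smul_def, ← hy (j + 1) j.2, Units.val_mul, mul_pow, Units.coe_map]
        simp only [MonoidHom.coe_coe]
        ring
      simp only [T]
      rw [h1, h2, map_smul, smul_eq_mul]
      ring
    have hcode : hammingNorm (c a) =
        Nat.card {x // Algebra.trace (ZMod 2) K (T x) ≠ 0} := by
      have hbij : Function.Bijective (fun i : Fin (q ^ 2 - 1) ↦ γ ^ (i : ℕ)) := by
        rw [Fintype.bijective_iff_injective_and_card]
        refine ⟨fun i j hij ↦ Fin.ext ?_, ?_⟩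
        · exact pow_injOn_Iio_orderOf (by simp [hγord]) (by simp [hγord]) hij
        · rw [Fintype.card_fin, ← hFu, Nat.card_eq_fintype_card]
      rw [hammingNorm, ← Fintype.card_subtype, ← Nat.card_eq_fintype_card]
      refine Nat.card_congr ((Equiv.ofBijective _ hbij).subtypeEquiv fun i ↦ ?_)
      have hρi : ρ (γ ^ (i : ℕ)) = g₀ ^ (i : ℕ) := by
        apply hinj
        rw [hρ, map_pow, hg₀, Units.val_pow_eq_pow_val, pow_right_comm]
      simp only [T, hc, Equiv.ofBijective_apply, hρi, map_add, Algebra.trace_trace,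
        Units.val_pow_eq_pow_val, ← pow_mul, mul_comm (i : ℕ)]
    let p : Fˣ → Prop := fun u ↦ algebraMap K F a.1 * (u : F) ^ t +
      ∑ j : Fin t, (a.2 j * (u : F) ^ (t + ((j : ℕ) + 1)) +
        a.2 j ^ q * (u : F) ^ (t - ((j : ℕ) + 1))) = 0
    have hTp : ∀ x, T x = 0 ↔ p (x ^ (h * (q - 1))) := by
      intro x
      have key : algebraMap K F (T x) * ((x ^ (h * (q - 1)) : Fˣ) : F) ^ t =
          (x : F) ^ d 0 * (algebraMap K F a.1 * ((x ^ (h * (q - 1)) : Fˣ) : F) ^ t +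
            ∑ j : Fin t, (a.2 j * ((x ^ (h * (q - 1)) : Fˣ) : F) ^ (t + ((j : ℕ) + 1)) +
              a.2 j ^ q * ((x ^ (h * (q - 1)) : Fˣ) : F) ^ (t - ((j : ℕ) + 1)))) := by
        have hfrob : ∀ f : Fin t → F, (∑ j, f j) ^ q = ∑ j, f j ^ q := fun f ↦ by
          rw [hq, sum_pow_char_pow]
        simp only [T]
        rw [map_add, map_mul, hρ, FiniteField.algebraMap_trace_eq_sum_pow, hfin,
          Finset.sum_range_succ, Finset.sum_range_one, pow_zero, pow_one, pow_one,
          Nat.card_eq_fintype_card, hK, hfrob, ← Finset.sum_add_distrib, add_mul,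
          Finset.sum_mul, mul_add, Finset.mul_sum]
        congr 1
        · ring
        · refine Finset.sum_congr rfl fun j _ ↦ ?_
          have h1 := congrArg (Units.val) (hx₁ (j + 1) j.2 x)
          have h2 := congrArg (Units.val) (hx₂ (j + 1) j.2 x)
          simp only [Units.val_mul, Units.val_pow_eq_pow_val] at h1 h2 ⊢
          generalize hu : ((x : F) ^ (h * (q - 1))) = u at *
          have h3 : u ^ t = u ^ ((j : ℕ) + 1) * u ^ (t - ((j : ℕ) + 1)) := by
            rw [← pow_add]; congr 1; omega
          rw [pow_add u t, mul_pow, add_mul, mul_add]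
          congr 1
          · rw [h1]; ring
          · rw [h3]
            linear_combination (a.2 j ^ q * u ^ (t - ((j : ℕ) + 1))) * h2
      constructor
      · intro h0
        rw [h0, map_zero, zero_mul] at key
        exact (mul_eq_zero.1 key.symm).resolve_left (pow_ne_zero _ x.ne_zero)
      · intro h0
        rw [show _ = (0 : F) from h0, mul_zero] at key
        exact (map_eq_zero _).1
          ((mul_eq_zero.1 key).resolve_right (pow_ne_zero _ (Units.ne_zero _)))
    let J := Nat.card {u : (powMonoidHom (h * (q - 1)) : Fˣ →* Fˣ).range // p u}
    have hJ : J ≤ 2 * t := by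
      refine card_laurent_roots_le (algebraMap K F a.1) a.2 (fun j ↦ a.2 j ^ q) ?_ _
        (fun u ↦ ((u.1 : Fˣ) : F))
        (fun u v huv ↦ Subtype.ext (Subtype.ext (Units.ext huv))) fun u ↦ u.2
      by_contra! hcon
      exact ha (Prod.ext ((map_eq_zero _).1 hcon.1) hcon.2)
    have hzero : Nat.card {x // T x = 0} = e * (q - 1) * J := by
      rw [Nat.card_congr (Equiv.subtypeEquivRight hTp), IsCyclic.card_subtype_pow, hFu, hfac,
        Nat.gcd_mul_right, Nat.gcd_comm, ← he]
    have hnz : Nat.card {x // T x = 0} + Nat.card {x // T x ≠ 0} = q ^ 2 - 1 := by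
      rw [← hFu, Nat.card_eq_fintype_card, Nat.card_eq_fintype_card, Nat.card_eq_fintype_card,
        Fintype.card_subtype_compl]
      exact Nat.add_sub_cancel' (Fintype.card_subtype_le _)
    have hcount := two_mul_card_units_mul_card_trace_ne_zero
      (Units.map (algebraMap K F : K →* F)) (r := Δ)
      (by rw [hKu]; exact (Nat.gcd_comm _ _).trans hΔ) T hT
    rw [← hcode, hKu, Nat.card_eq_fintype_card (α := K), hK] at hcount
    refine ⟨J, hJ, ?_⟩
    rw [hzero] at hnz
    zify at hcount hnz
    rw [hFcast, hKcast] at hnz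
    rw [hKcast] at hcount
    refine mul_left_cancel₀ (sub_ne_zero.2 hqZ.ne') ?_
    linear_combination hcount + (q : ℤ) * hnz
  refine ⟨hweight, ?_⟩
  let W := (Finset.range (2 * t + 1)).image
    fun j : ℕ ↦ (((q : ℤ) ^ 2 - ((j : ℤ) * e - 1) * q) / 2).toNat
  have hsub : {w : ℕ | ∃ a : K × (Fin t → F), a ≠ 0 ∧ hammingNorm (c a) = w} ⊆ W := by
    rintro w ⟨a, ha, rfl⟩
    obtain ⟨j, hj, hw⟩ := hweight a ha
    exact Finset.mem_coe.2
      (Finset.mem_image.2 ⟨j, Finset.mem_range.2 (by omega), by rw [← hw]; omega⟩)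
  calc _ ≤ (W : Set ℕ).ncard := Set.ncard_le_ncard hsub W.finite_toSet
    _ = W.card := Set.ncard_coe_finset W
    _ ≤ 2 * t + 1 := Finset.card_image_le.trans (Finset.card_range _).le
end

section
/- For any t with 1 ≤ t ≤ (q+1)/(2e), the map a ↦ c̃(a) from (F_{q²})^t to the code C^(2) is injective; in particular, the p-ary cyclic code C^(2) of length q²−1 contains exactly p^{2tm} codewords, i.e., has dimension 2tm over F_p. -/
theorem dvd_of_pow_modEq_one {p m k : ℕ} (hp : 2 ≤ p) (h : p ^ k ≡ 1 [MOD p ^ m - 1]) :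
    m ∣ k := by
  have hdvd : p ^ m - 1 ∣ p ^ k - 1 :=
    (Nat.modEq_iff_dvd' (Nat.one_le_pow _ _ (by omega))).1 h.symm
  have hgcd := Nat.pow_sub_one_gcd_pow_sub_one p m k
  rw [Nat.gcd_eq_left hdvd] at hgcd
  have h1 : 1 ≤ p ^ m := Nat.one_le_pow _ _ (by omega)
  have h2 : 1 ≤ p ^ m.gcd k := Nat.one_le_pow _ _ (by omega)
  have heq : m = m.gcd k := Nat.pow_right_injective hp (by simp only; omega)
  rw [heq]
  exact Nat.gcd_dvd_right m k

theorem eq_zero_of_dvd_mul_of_abs_mul_gcd_lt {h N : ℕ} {n : ℤ} (hdvd : (N : ℤ) ∣ n * h)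
    (hlt : |n| * (h.gcd N : ℤ) < N) : n = 0 := by
  have h1 : N ∣ n.natAbs * h := by
    have := Int.natAbs_dvd_natAbs.2 hdvd
    simpa [Int.natAbs_mul] using this
  have h2 : N ∣ n.natAbs * h.gcd N := by
    rw [← Nat.gcd_mul_left]
    exact Nat.dvd_gcd h1 (dvd_mul_left _ _)
  have hN : 0 < N := by
    have : (0 : ℤ) ≤ |n| * (h.gcd N : ℤ) := by positivity
    omega
  have h3 : n.natAbs * h.gcd N < N := by
    rw [Int.abs_eq_natAbs] at hlt
    exact_mod_cast hlt
  have h4 := Nat.eq_zero_of_dvd_of_lt h2 h3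
  have h5 : 0 < h.gcd N := Nat.gcd_pos_of_pos_right _ hN
  rcases Nat.mul_eq_zero.1 h4 with h6 | h6
  · exact Int.natAbs_eq_zero.1 h6
  · omega

theorem FiniteField.eq_zero_of_forall_trace_sum_eq_zero {p : ℕ} [Fact p.Prime] {F : Type*} [Field F]
    [Fintype F] [Algebra (ZMod p) F] {γ : Fˣ} (hγ : ∀ x : Fˣ, x ∈ Subgroup.zpowers γ)
    {ι : Type*} [Fintype ι] {d : ι → ℕ}
    (hd : ∀ i j k, k < Module.finrank (ZMod p) F →
      d j * p ^ k ≡ d i [MOD Fintype.card F - 1] → j = i ∧ k = 0)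
    {a : ι → F}
    (ha : ∀ n < Fintype.card F - 1,
      Algebra.trace (ZMod p) F (∑ j, a j * (γ : F) ^ (d j * n)) = 0) : a = 0 := by
  classical
  have hcard : Fintype.card F = p ^ Module.finrank (ZMod p) F := by
    simpa [ZMod.card] using Module.card_eq_pow_finrank (K := ZMod p) (V := F)
  have hrank : 0 < Module.finrank (ZMod p) F := Module.finrank_pos
  have hord : orderOf γ = Fintype.card F - 1 := by
    rw [orderOf_eq_card_of_forall_mem_zpowers hγ, Nat.card_eq_fintype_card, Fintype.card_units]
  have hcop : Nat.Coprime (Fintype.card F - 1) p := by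
    refine (Nat.Prime.coprime_iff_not_dvd Fact.out).2 (fun hdvd => ?_) |>.symm
    have h1 : p ∣ Fintype.card F := hcard ▸ dvd_pow_self p hrank.ne'
    have h2 : 1 < Fintype.card F := Fintype.one_lt_card
    have h3 := Nat.dvd_sub h1 hdvd
    rw [Nat.sub_sub_self h2.le] at h3
    exact (Fact.out : p.Prime).one_lt.ne' (Nat.dvd_one.1 h3)
  let χ : ι × Fin (Module.finrank (ZMod p) F) → (Fˣ →* F) := fun r =>
    (Units.coeHom F).comp (powMonoidHom (d r.1 * p ^ (r.2 : ℕ)))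
  have hle : ∀ r s, (s.2 : ℕ) ≤ r.2 → χ r = χ s → r = s := by
    intro r s hrs heq
    have h1 : γ ^ (d r.1 * p ^ (r.2 : ℕ)) = γ ^ (d s.1 * p ^ (s.2 : ℕ)) :=
      Units.ext (DFunLike.congr_fun heq γ)
    rw [pow_eq_pow_iff_modEq, hord, ← Nat.sub_add_cancel hrs, pow_add, ← mul_assoc] at h1
    have h2 := Nat.ModEq.cancel_right_of_coprime (hcop.pow_right _) h1
    obtain ⟨h3, h4⟩ := hd _ _ _ (lt_of_le_of_lt (Nat.sub_le _ _) r.2.2) h2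
    exact Prod.ext h3 (Fin.ext (by omega))
  have hinj : Function.Injective χ := fun r s heq =>
    (le_total (s.2 : ℕ) r.2).elim (fun hrs => hle r s hrs heq) fun hsr => (hle s r hsr heq.symm).symm
  have hlin := (linearIndependent_monoidHom Fˣ F).comp χ hinj
  rw [Fintype.linearIndependent_iff] at hlin
  have hzero := hlin (fun r => a r.1 ^ p ^ (r.2 : ℕ)) <| by
    funext x
    obtain ⟨n, hn, rfl⟩ : ∃ n < Fintype.card F - 1, γ ^ n = x := by
      have hx := hγ x
      rw [mem_zpowers_iff_mem_range_orderOf, hord] at hx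
      simpa using hx
    have htr := congrArg (algebraMap (ZMod p) F) (ha n hn)
    rw [FiniteField.algebraMap_trace_eq_sum_pow, map_zero, Nat.card_zmod, Finset.sum_range] at htr
    have : CharP F p := charP_of_injective_algebraMap (algebraMap (ZMod p) F).injective p
    simp only [sum_pow_char_pow] at htr
    rw [Finset.sum_comm, ← Fintype.sum_prod_type'] at htr
    rw [Finset.sum_apply, Pi.zero_apply, ← htr]
    refine Finset.sum_congr rfl fun r _ => ?_
    simp only [χ, Function.comp_apply, Pi.smul_apply, MonoidHom.comp_apply, powMonoidHom_apply,
      Units.coeHom_apply, Units.val_pow_eq_pow_val, smul_eq_mul, mul_pow, ← pow_mul]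
    ring_nf
  funext i
  simpa using hzero (i, ⟨0, hrank⟩)

/-- Distinctness modulo `q ^ 2 - 1` of the conjugates of the generalized Niho exponents. -/
theorem niho_exponent_mul_pow_modEq {p m q h Δ t : ℕ} (hp : p.Prime) (hm : 0 < m)
    (hq : q = p ^ m) (hΔ : Nat.gcd Δ (q - 1) = 1) (ht : 2 * h.gcd (q + 1) * t ≤ q + 1)
    {d : ℕ → ℕ} {s : ℕ → ℤ}
    (hs : ∀ j, 1 ≤ j → j ≤ t →
      2 * s j ≡ 2 * (j : ℤ) * h + ((Δ : ℤ) - h)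
        [ZMOD (if p = 2 then (q : ℤ) + 1 else 2 * ((q : ℤ) + 1))])
    (hd : ∀ j, 1 ≤ j → j ≤ t →
      (d j : ℤ) ≡ s j * ((q : ℤ) - 1) + Δ [ZMOD ((q : ℤ) ^ 2 - 1)])
    {i j k : ℕ} (hi1 : 1 ≤ i) (hit : i ≤ t) (hj1 : 1 ≤ j) (hjt : j ≤ t) (hk : k < 2 * m)
    (hmod : d j * p ^ k ≡ d i [MOD q ^ 2 - 1]) : j = i ∧ k = 0 := by
  have hq2 : 2 ≤ q := hq ▸ hp.two_le.trans (Nat.le_self_pow hm.ne' p)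
  have hmodZ : (d j : ℤ) * (p : ℤ) ^ k ≡ d i [ZMOD (q : ℤ) ^ 2 - 1] := by
    have := Int.natCast_modEq_iff.2 hmod
    rw [Nat.cast_sub (Nat.one_le_pow _ _ (by omega))] at this
    exact_mod_cast this
  have hfac : (q : ℤ) ^ 2 - 1 = ((q : ℤ) + 1) * ((q : ℤ) - 1) := by ring
  have hq1 : ((q : ℤ) - 1) ∣ (q : ℤ) ^ 2 - 1 := hfac ▸ dvd_mul_left _ _
  have hdΔ : ∀ j, 1 ≤ j → j ≤ t → (d j : ℤ) ≡ Δ [ZMOD (q : ℤ) - 1] := fun j h1 h2 =>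
    ((hd j h1 h2).of_dvd hq1).trans <| Int.modEq_iff_dvd.2 ⟨-s j, by ring⟩
  have hΔk : (Δ : ℤ) * (p : ℤ) ^ k ≡ Δ * 1 [ZMOD (q : ℤ) - 1] := by
    rw [mul_one]
    exact ((hdΔ j hj1 hjt).symm.mul_right _).trans
      ((hmodZ.of_dvd hq1).trans (hdΔ i hi1 hit))
  have hpk : p ^ k ≡ 1 [MOD p ^ m - 1] := by
    rw [← hq]
    refine Nat.ModEq.cancel_left_of_coprime (c := Δ) (by rw [Nat.gcd_comm]; exact hΔ) ?_
    rw [← Int.natCast_modEq_iff, Nat.cast_sub (by omega)]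
    exact_mod_cast hΔk
  have hdvd2 : ∀ X : ℤ, (if p = 2 then (q : ℤ) + 1 else 2 * ((q : ℤ) + 1)) ∣ 2 * X →
      (q : ℤ) + 1 ∣ X := by
    intro X hX
    split_ifs at hX with hp2
    · refine IsCoprime.dvd_of_dvd_mul_left ?_ hX
      refine ⟨1, -2 ^ (m - 1), ?_⟩
      obtain ⟨r, rfl⟩ : ∃ r, m = r + 1 := ⟨m - 1, by omega⟩
      subst hp2
      rw [hq]
      push_cast
      ring
    · exact (mul_dvd_mul_iff_left two_ne_zero).1 hX
  have hsi := (hs i hi1 hit).dvd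
  have hsj := (hs j hj1 hjt).dvd
  have hqne : (q : ℤ) - 1 ≠ 0 := by omega
  have htZ : 2 * (h.gcd (q + 1) : ℤ) * t ≤ q + 1 := by exact_mod_cast ht
  have hepos : (0 : ℤ) < h.gcd (q + 1) := by
    exact_mod_cast Nat.gcd_pos_of_pos_right _ (Nat.succ_pos q)
  have hsmall : ∀ n : ℤ, |n| < 2 * t → (q : ℤ) + 1 ∣ n * h → n = 0 := by
    intro n hn hdvd
    refine eq_zero_of_dvd_mul_of_abs_mul_gcd_lt (h := h) (N := q + 1) (by exact_mod_cast hdvd) ?_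
    push_cast
    nlinarith
  have hdi := hd i hi1 hit
  have hdj := hd j hj1 hjt
  obtain ⟨l, rfl⟩ := dvd_of_pow_modEq_one hp.two_le hpk
  have hl : l < 2 := by
    by_contra hl
    nlinarith
  interval_cases l
  · refine ⟨?_, by simp⟩
    rw [mul_zero, pow_zero, mul_one] at hmodZ
    have h1 := ((hdj.symm.trans hmodZ).trans hdi).dvd
    have h2 : (q : ℤ) + 1 ∣ s i - s j := by
      rw [hfac] at h1
      refine (mul_dvd_mul_iff_right hqne).1 (h1.trans (dvd_of_eq (by ring)))
    have h3 : (q : ℤ) + 1 ∣ ((i : ℤ) - j) * h - (s i - s j) :=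
      hdvd2 _ ((dvd_sub hsi hsj).trans (dvd_of_eq (by ring)))
    have h4 := hsmall ((i : ℤ) - j) (by rw [abs_lt]; omega) (by simpa using dvd_add h3 h2)
    omega
  · exfalso
    have hqk : (p : ℤ) ^ (m * 1) = q := by rw [hq, mul_one]; push_cast; rfl
    rw [hqk] at hmodZ
    have h1 := (((hdj.symm.mul_right _).trans hmodZ).trans hdi).dvd
    have h2 : (q : ℤ) + 1 ∣ s i + s j - Δ := by
      have h5 : (q : ℤ) ^ 2 - 1 ∣ s i * ((q : ℤ) - 1) + Δ - (s j * ((q : ℤ) - 1) + Δ) * q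
          + s j * ((q : ℤ) ^ 2 - 1) := dvd_add h1 (dvd_mul_left _ _)
      rw [hfac] at h5
      refine (mul_dvd_mul_iff_right hqne).1 (h5.trans (dvd_of_eq (by ring)))
    have h3 : (q : ℤ) + 1 ∣ ((i : ℤ) + j - 1) * h - (s i + s j - Δ) :=
      hdvd2 _ ((dvd_add hsi hsj).trans (dvd_of_eq (by ring)))
    have h4 := hsmall ((i : ℤ) + j - 1) (by rw [abs_lt]; omega) (by simpa using dvd_add h3 h2)
    omega


/-- Theorem 1(ii), dimension part: with `p` prime, `q = p^m`, `F` the field with `q²`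
elements, `γ` a generator of `Fˣ`, and generalized Niho-type exponents `d̃_1, …, d̃_t` as in
the paper, the codeword map `a ↦ c̃(a)` of the `p`-ary cyclic code `C⁽²⁾`,
`c̃(a)_i = Tr_{q²/p}(∑_{j=1}^t a_j γ^{d̃_j i})`, is injective on `(F_{q²})^t`; in particular
the code has exactly `p^{2tm}` codewords, i.e. dimension `2tm` over `F_p`. -/
theorem stmt_6 (p m : ℕ) (hp : p.Prime) (hm : 0 < m) (q : ℕ) (hq : q = p ^ m)
    (F : Type*) [Field F] [Fintype F] [Algebra (ZMod p) F]
    (hF : Fintype.card F = q ^ 2)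
    (γ : Fˣ) (hγ : ∀ x : Fˣ, x ∈ Subgroup.zpowers γ)
    (h Δ : ℕ) (hh : 0 < h) (hΔpos : 0 < Δ)
    (hhq : ¬ (q + 1) ∣ h) (hΔ : Nat.gcd Δ (q - 1) = 1)
    (hparity : p ≠ 2 → Odd Δ ∧ Odd h)
    (e : ℕ) (he : e = Nat.gcd h (q + 1))
    (t : ℕ) (ht1 : 1 ≤ t) (ht : 2 * e * t ≤ q + 1)
    (d : ℕ → ℕ) (s : ℕ → ℤ)
    (hdpos : ∀ j, 1 ≤ j → j ≤ t → 0 < d j)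
    (hs : ∀ j, 1 ≤ j → j ≤ t →
      2 * s j ≡ 2 * (j : ℤ) * h + ((Δ : ℤ) - h)
        [ZMOD (if p = 2 then (q : ℤ) + 1 else 2 * ((q : ℤ) + 1))])
    (hd : ∀ j, 1 ≤ j → j ≤ t →
      (d j : ℤ) ≡ s j * ((q : ℤ) - 1) + Δ [ZMOD ((q : ℤ) ^ 2 - 1)])
    (c : (Fin t → F) → Fin (q ^ 2 - 1) → ZMod p)
    (hc : ∀ a i, c a i =
      Algebra.trace (ZMod p) F
        (∑ j : Fin t, a j * (γ : F) ^ (d ((j : ℕ) + 1) * (i : ℕ)))) :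
    Function.Injective c ∧ Nat.card (Set.range c) = p ^ (2 * t * m) := by
  have : Fact p.Prime := ⟨hp⟩
  have hrank : Module.finrank (ZMod p) F = 2 * m := by
    have h1 : Fintype.card F = p ^ Module.finrank (ZMod p) F := by
      simpa [ZMod.card] using Module.card_eq_pow_finrank (K := ZMod p) (V := F)
    rw [hF, hq, ← pow_mul, mul_comm m 2] at h1
    exact (Nat.pow_right_injective hp.two_le h1).symm
  have hinj : Function.Injective c := by
    intro a b hab
    refine sub_eq_zero.1 <|
      FiniteField.eq_zero_of_forall_trace_sum_eq_zero (p := p) hγ (d := fun j : Fin t => d (j + 1))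
        (fun i j k hk hmod => ?_) fun n hn => ?_
    · rw [hF] at hmod
      obtain ⟨h1, h2⟩ := niho_exponent_mul_pow_modEq hp hm hq hΔ (he ▸ ht) hs hd
        (i := i + 1) (j := j + 1) (by omega) i.2 (by omega) j.2 (hrank ▸ hk) hmod
      exact ⟨Fin.ext (by omega), h2⟩
    · have h1 := congrFun hab ⟨n, hF ▸ hn⟩
      rw [hc, hc, ← sub_eq_zero, ← map_sub, ← Finset.sum_sub_distrib] at h1
      simpa only [Pi.sub_apply, sub_mul] using h1
  refine ⟨hinj, ?_⟩
  rw [Nat.card_range_of_injective hinj, Nat.card_eq_fintype_card, Fintype.card_fun, hF,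
    Fintype.card_fin, hq, ← pow_mul, ← pow_mul]
  congr 1
  ring
end

section
/- For any t with 1 ≤ t ≤ (q+1)/(2e) and any nonzero a = (a_1, …, a_t) ∈ (F_{q²})^t, the Hamming weight of the codeword c̃(a) of C^(2) equals ((p−1)/p)·(q² − (je−1)q) for some integer j with 0 ≤ j ≤ 2t−1. In particular, C^(2) has at most 2t distinct nonzero weights. -/
open Finset Polynomial

/-- A nonzero linear functional on a finite `ZMod p`-space is nonzero at `(p - 1) / p` of all
vectors. -/
lemma card_linearFunctional_ne_zero {p : ℕ} [Fact p.Prime] {V : Type*} [AddCommGroup V]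
    [Module (ZMod p) V] [Fintype V] (f : V →ₗ[ZMod p] ZMod p) (hf : f ≠ 0) :
    (p : ℤ) * #{v | f v ≠ 0} = (p - 1) * Fintype.card V := by
  have hidx := f.toAddMonoidHom.ker.card_mul_index
  have hrange : f.toAddMonoidHom.range = ⊤ :=
    AddMonoidHom.range_eq_top.2 (LinearMap.surjective hf)
  rw [AddSubgroup.index_ker, hrange, AddSubgroup.card_top, Nat.card_zmod,
    Nat.card_eq_fintype_card (α := V)] at hidx
  have hker : Nat.card f.toAddMonoidHom.ker = #{v | f v = 0} := by
    rw [← Fintype.card_subtype, ← Nat.card_eq_fintype_card]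
    rfl
  have hsplit := card_filter_add_card_filter_not (s := (univ : Finset V)) (fun v => f v = 0)
  rw [card_univ] at hsplit
  rw [hker] at hidx
  zify at hidx hsplit
  linear_combination (p : ℤ) * hsplit - hidx

/-- Among the `Δ`-th powers of units of a finite field, with `Δ` coprime to the order of the unit
group, the trace form against a fixed nonzero element is nonzero `(p - 1) / p * |K|` times. -/
lemma card_units_trace_pow_mul_ne_zero {p : ℕ} [Fact p.Prime] {K : Type*} [Field K] [Fintype K]
    [DecidableEq K] [Algebra (ZMod p) K] {Δ : ℕ} (hΔ : (Fintype.card K - 1).Coprime Δ)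
    {b : K} (hb : b ≠ 0) :
    (p : ℤ) * #{y : Kˣ | Algebra.trace (ZMod p) K ((y : K) ^ Δ * b) ≠ 0} =
      (p - 1) * Fintype.card K := by
  have hne : (Algebra.traceForm (ZMod p) K).flip b ≠ 0 := fun h0 =>
    hb ((traceForm_nondegenerate (ZMod p) K).2 b fun y => by
      simpa using LinearMap.congr_fun h0 y)
  rw [← card_linearFunctional_ne_zero _ hne]
  have hcard : (Nat.card Kˣ).Coprime Δ := by
    rwa [Nat.card_units, Nat.card_eq_fintype_card]
  congr 2
  refine card_bij (fun y _ => (y : K) ^ Δ) (fun y hy => mem_filter.2 ⟨mem_univ _, ?_⟩) ?_ ?_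
  · simpa using hy
  · intro x _ y _ hxy
    exact (powCoprime hcard).injective (Units.ext (by simpa using hxy))
  · intro z hz
    replace hz := (mem_filter.1 hz).2
    have hz0 : z ≠ 0 := by
      rintro rfl
      simp at hz
    obtain ⟨y, hy⟩ := (powCoprime hcard).surjective (Units.mk0 z hz0)
    have hyz : (y : K) ^ Δ = z := by simpa using congrArg Units.val hy
    exact ⟨y, by simpa [hyz] using hz, hyz⟩

/-- The trace of a quadratic extension of finite fields. -/
lemma algebraMap_trace_of_card_sq {K F : Type*} [Field K] [Fintype K] [Field F] [Fintype F]
    [Algebra K F] (hF : Fintype.card F = Fintype.card K ^ 2) (g : F) :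
    algebraMap K F (Algebra.trace K F g) = g + g ^ Fintype.card K := by
  have hrank : Module.finrank K F = 2 :=
    Nat.pow_right_injective (Fintype.one_lt_card (α := K))
      ((Module.card_eq_pow_finrank (K := K) (V := F)).symm.trans hF)
  rw [FiniteField.algebraMap_trace_eq_sum_pow, hrank]
  simp [Finset.sum_range_succ]

/-- The trace of `y ^ Δ * g`, for `y` in the units of the subfield `K` of index two, is either
identically zero or nonzero `(p - 1) / p * |K|` times. -/
lemma card_units_trace_pow_mul_algebraMap_ne_zero {p : ℕ} [Fact p.Prime] {K F : Type*} [Field K]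
    [Fintype K] [Field F] [Fintype F] [DecidableEq F] [DecidableEq K] [Algebra (ZMod p) K]
    [Algebra (ZMod p) F] [Algebra K F] [IsScalarTower (ZMod p) K F]
    (hF : Fintype.card F = Fintype.card K ^ 2) {Δ : ℕ} (hΔ : (Fintype.card K - 1).Coprime Δ) (g : F) :
    (p : ℤ) * #{y : Kˣ | Algebra.trace (ZMod p) F (algebraMap K F y ^ Δ * g) ≠ 0} =
      if g + g ^ Fintype.card K ≠ 0 then ((p : ℤ) - 1) * Fintype.card K else 0 := by
  classical
  have htr (y : Kˣ) : Algebra.trace (ZMod p) F (algebraMap K F y ^ Δ * g) =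
      Algebra.trace (ZMod p) K ((y : K) ^ Δ * Algebra.trace K F g) := by
    rw [← Algebra.trace_trace (S := K), ← map_pow, ← Algebra.smul_def, map_smul, smul_eq_mul]
  simp_rw [htr, ← algebraMap_trace_of_card_sq hF g]
  split_ifs with h0
  · exact card_units_trace_pow_mul_ne_zero hΔ fun h => h0 (by rw [h, map_zero])
  · have : Algebra.trace K F g = 0 := by simpa using h0
    simp [this]

/-- Averaging the trace of a function that is `Δ`-homogeneous over the subfield `K`. -/
lemma card_trace_ne_zero_of_homogeneous {p : ℕ} [Fact p.Prime] {K F : Type*} [Field K]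
    [Fintype K] [Field F] [Fintype F] [DecidableEq F] [DecidableEq K] [Algebra (ZMod p) K]
    [Algebra (ZMod p) F] [Algebra K F] [IsScalarTower (ZMod p) K F]
    (hF : Fintype.card F = Fintype.card K ^ 2) {Δ : ℕ} (hΔ : (Fintype.card K - 1).Coprime Δ) (G : Fˣ → F)
    (hG : ∀ (y : Kˣ) x, G (Units.map (algebraMap K F) y * x) = algebraMap K F y ^ Δ * G x) :
    ((Fintype.card K : ℤ) - 1) * (p * #{x | Algebra.trace (ZMod p) F (G x) ≠ 0}) =
      (p - 1) * Fintype.card K * #{x | G x + G x ^ Fintype.card K ≠ 0} := by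
  classical
  have hcount : Fintype.card Kˣ * #{x | Algebra.trace (ZMod p) F (G x) ≠ 0} =
      ∑ x, #{y : Kˣ | Algebra.trace (ZMod p) F (algebraMap K F y ^ Δ * G x) ≠ 0} := by
    rw [← card_univ, ← smul_eq_mul, ← sum_const]
    simp_rw [card_filter]
    conv_rhs => rw [sum_comm]
    refine sum_congr rfl fun y _ => ?_
    rw [← Equiv.sum_comp (Equiv.mulLeft (Units.map (algebraMap K F : K →* F) y))]
    simp [hG]
  rw [Fintype.card_units] at hcount
  zify [Fintype.card_pos (α := K)] at hcount
  rw [mul_left_comm, hcount, mul_sum]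
  simp_rw [card_units_trace_pow_mul_algebraMap_ne_zero hF hΔ]
  rw [← sum_filter, sum_const, nsmul_eq_mul, mul_comm]

/-- In a finite cyclic group, the number of `x` with `x ^ n ∈ S` is a multiple of the number of
`n`-torsion elements. -/
lemma exists_card_pow_mem_eq {A : Type*} [CommGroup A] [IsCyclic A] [Fintype A] [DecidableEq A]
    (n : ℕ) (S : Finset A) : ∃ j ≤ #S, #{x : A | x ^ n ∈ S} = (Nat.card A).gcd n * j := by
  refine ⟨#{w ∈ S | w ∈ Set.range (powMonoidHom n : A →* A)}, card_filter_le _ _, ?_⟩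
  rw [card_eq_sum_card_fiberwise (f := fun x : A => x ^ n)
    (t := {w ∈ S | w ∈ Set.range (powMonoidHom n : A →* A)})]
  · rw [mul_comm, ← smul_eq_mul, ← sum_const]
    refine sum_congr rfl fun w hw => ?_
    simp only [mem_filter] at hw
    have hfib : {x ∈ ({x : A | x ^ n ∈ S} : Finset A) | x ^ n = w} =
        ({x | powMonoidHom n x = w} : Finset A) := by
      ext x
      simp only [mem_filter, mem_univ, true_and, powMonoidHom_apply, and_iff_right_iff_imp]
      rintro rfl
      exact hw.1
    rw [hfib, ← IsCyclic.card_powMonoidHom_ker, Nat.card_eq_fintype_card, Fintype.card_subtype]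
    simp only [MonoidHom.mem_ker]
    exact MonoidHom.card_fiber_eq_of_mem_range (powMonoidHom n : A →* A) hw.2 ⟨1, map_one _⟩
  · intro x hx
    simpa using hx

/-- The Laurent polynomial `∑ a_j (w ^ (j + 1)) + a_j ^ q * w ^ (-j)` has few nonzero roots. -/
lemma exists_polynomial_eval_eq_zero_iff {F : Type*} [Field F] (q t : ℕ) {a : Fin t → F}
    (ha : a ≠ 0) : ∃ P : F[X], P ≠ 0 ∧ P.natDegree ≤ 2 * t - 1 ∧ ∀ w : F, w ≠ 0 →
      (P.eval w = 0 ↔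
        ∑ j : Fin t, (a j * w ^ ((j : ℤ) + 1) + a j ^ q * w ^ (-(j : ℤ))) = 0) := by
  refine ⟨∑ j : Fin t, (C (a j) * X ^ (t + j) + C (a j ^ q) * X ^ (t - 1 - j)), ?_, ?_, ?_⟩
  · obtain ⟨i, hi⟩ := Function.ne_iff.1 ha
    refine fun h0 => hi ?_
    have hcoeff := congrArg (fun P => P.coeff (t + i)) h0
    simp only [finsetSum_coeff, coeff_add, coeff_C_mul, coeff_X_pow, coeff_zero] at hcoeff
    rw [sum_eq_single i] at hcoeff
    · have : t + (i : ℕ) ≠ t - 1 - i := by omega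
      simpa [this] using hcoeff
    · intro j _ hj
      have h1 : (i : ℕ) ≠ j := (Fin.val_ne_of_ne hj).symm
      have h2 : t + (i : ℕ) ≠ t - 1 - j := by omega
      simp [h1, h2]
    · simp
  · refine natDegree_sum_le_of_forall_le _ _ fun j _ => ?_
    refine natDegree_add_le_of_degree_le ?_ ?_
    · exact (natDegree_C_mul_X_pow_le _ _).trans (by omega)
    · exact (natDegree_C_mul_X_pow_le _ _).trans (by omega)
  · intro w hw
    have heval :
        (∑ j : Fin t, (C (a j) * X ^ (t + j) + C (a j ^ q) * X ^ (t - 1 - j)) : F[X]).eval w = w ^ ((t : ℤ) - 1) *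
          ∑ j : Fin t, (a j * w ^ ((j : ℤ) + 1) + a j ^ q * w ^ (-(j : ℤ))) := by
      rw [eval_finsetSum, mul_sum]
      refine sum_congr rfl fun j _ => ?_
      have h1 : w ^ (t + (j : ℕ)) = w ^ ((t : ℤ) - 1) * w ^ ((j : ℤ) + 1) := by
        rw [← zpow_add₀ hw, ← zpow_natCast]
        congr 1
        push_cast
        ring
      have h2 : w ^ (t - 1 - (j : ℕ)) = w ^ ((t : ℤ) - 1) * w ^ (-(j : ℤ)) := by
        rw [← zpow_add₀ hw, ← zpow_natCast]
        congr 1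
        omega
      simp only [eval_add, eval_mul, eval_C, eval_pow, eval_X, h1, h2]
      ring
    rw [heval, mul_eq_zero, or_iff_right (zpow_ne_zero _ hw)]

/-- A quadratic extension of finite fields over `ZMod p` contains a subfield of index two. -/
lemma exists_algHom_galoisField {p m : ℕ} [Fact p.Prime] (hm : 0 < m) {F : Type*} [Field F]
    [Fintype F] [Algebra (ZMod p) F] (hF : Fintype.card F = (p ^ m) ^ 2) :
    Nonempty (GaloisField p m →ₐ[ZMod p] F) := by
  refine FiniteField.nonempty_algHom_of_finrank_dvd ?_
  have hcard := Module.card_eq_pow_finrank (K := ZMod p) (V := F)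
  rw [ZMod.card, hF, ← pow_mul] at hcard
  rw [GaloisField.finrank p hm.ne',
    ← Nat.pow_right_injective (Fact.out : p.Prime).two_le hcard]
  exact dvd_mul_right _ _

/-- The exponents `s j` have the form `j * h + r` modulo `q + 1`, with `2 * r = Δ - h`. -/
lemma exists_half_shift {p q : ℕ} (hpq : p = 2 → Even q) {h Δ : ℕ}
    (hparity : p ≠ 2 → Odd Δ ∧ Odd h) {t : ℕ} {s : ℕ → ℤ}
    (hs : ∀ j, 1 ≤ j → j ≤ t →
      2 * s j ≡ 2 * (j : ℤ) * h + ((Δ : ℤ) - h)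
        [ZMOD (if p = 2 then (q : ℤ) + 1 else 2 * ((q : ℤ) + 1))]) :
    ∃ r : ℤ, (q : ℤ) + 1 ∣ 2 * r + h - Δ ∧
      ∀ j, 1 ≤ j → j ≤ t → (q : ℤ) + 1 ∣ s j - (j * h + r) := by
  by_cases hp2 : p = 2
  · obtain ⟨k, hk⟩ := hpq hp2
    have hr : (q : ℤ) + 1 ∣ 2 * (((Δ : ℤ) - h) * (k + 1)) + h - Δ :=
      ⟨(Δ : ℤ) - h, by rw [hk]; push_cast; ring⟩
    refine ⟨((Δ : ℤ) - h) * (k + 1), hr, fun j h1 h2 => ?_⟩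
    have hj := (hs j h1 h2).symm.dvd
    rw [if_pos hp2] at hj
    have hcop : IsCoprime ((q : ℤ) + 1) 2 := ⟨1, -k, by rw [hk]; push_cast; ring⟩
    refine hcop.dvd_of_dvd_mul_left ?_
    convert dvd_sub hj hr using 1
    ring
  · obtain ⟨⟨u, hu⟩, ⟨v, hv⟩⟩ := hparity hp2
    refine ⟨(u : ℤ) - v, ⟨0, by rw [hu, hv]; push_cast; ring⟩, fun j h1 h2 => ?_⟩
    have hj := (hs j h1 h2).symm.dvd
    rw [if_neg hp2] at hj
    refine (mul_dvd_mul_iff_left (two_ne_zero (α := ℤ))).1 (hj.trans (dvd_of_eq ?_))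
    rw [hu, hv]
    push_cast
    ring

/-- Powers of a unit of a finite field agree when the exponents agree modulo `|K| - 1`. -/
lemma zpow_eq_zpow_of_card_sub_one_dvd {K : Type*} [Field K] [Fintype K] (x : Kˣ) {a b : ℤ}
    (hab : (Fintype.card K : ℤ) - 1 ∣ a - b) : x ^ a = x ^ b := by
  classical
  refine zpow_eq_zpow_iff_modEq.2 (Int.ModEq.symm (Int.modEq_iff_dvd.2 (dvd_trans ?_ hab)))
  have hx := orderOf_dvd_card (x := x)
  rw [Fintype.card_units] at hx
  zify [Fintype.card_pos (α := K)] at hx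
  exact hx

/-- Adding the conjugate to `∑ a_j x ^ d_j` yields a Laurent polynomial in `x ^ ((q - 1) h)`, up to
a unit factor. -/
lemma sum_add_sum_pow_eq {p m q : ℕ} [Fact p.Prime] (hq : q = p ^ m) {F : Type*} [Field F]
    [Fintype F] [CharP F p] (hF : Fintype.card F = q ^ 2) {h Δ t : ℕ} {d : ℕ → ℕ} {s : ℕ → ℤ}
    {r : ℤ} (hr : (q : ℤ) + 1 ∣ 2 * r + h - Δ)
    (hs : ∀ j, 1 ≤ j → j ≤ t → (q : ℤ) + 1 ∣ s j - (j * h + r))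
    (hd : ∀ j, 1 ≤ j → j ≤ t →
      (d j : ℤ) ≡ s j * ((q : ℤ) - 1) + Δ [ZMOD ((q : ℤ) ^ 2 - 1)])
    (a : Fin t → F) (x : Fˣ) :
    (∑ j : Fin t, a j * (x : F) ^ d (j + 1)) + (∑ j : Fin t, a j * (x : F) ^ d (j + 1)) ^ q =
      ((x ^ (Δ + (q - 1) * r : ℤ) : Fˣ) : F) * ∑ j : Fin t,
        (a j * ((x ^ ((q - 1) * h) : Fˣ) : F) ^ ((j : ℤ) + 1) +
          a j ^ q * ((x ^ ((q - 1) * h) : Fˣ) : F) ^ (-(j : ℤ))) := by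
  have hq1 : 1 ≤ q := hq ▸ Nat.one_le_pow _ _ (Fact.out : p.Prime).pos
  have hcard : (Fintype.card F : ℤ) - 1 = (q - 1) * (q + 1) := by
    rw [hF]
    push_cast
    ring
  have hsum : (∑ j : Fin t, a j * (x : F) ^ d (j + 1)) ^ q =
      ∑ j : Fin t, a j ^ q * (x : F) ^ (d (j + 1) * q) := by
    rw [hq, sum_pow_char_pow]
    simp_rw [mul_pow, pow_mul]
  rw [hsum, ← sum_add_distrib, mul_sum]
  refine sum_congr rfl fun j _ => ?_
  have hsj := hs (j + 1) (by omega) (by omega)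
  have hdj := (hd (j + 1) (by omega) (by omega)).symm.dvd
  obtain ⟨u, hu⟩ := hr
  obtain ⟨v, hv⟩ := hsj
  obtain ⟨w, hw⟩ := hdj
  push_cast at hv
  have h1 : x ^ d (j + 1) =
      x ^ (Δ + (q - 1) * r : ℤ) * (x ^ ((q - 1) * h)) ^ ((j : ℤ) + 1) := by
    rw [← zpow_natCast x, ← zpow_natCast x, ← zpow_mul, ← zpow_add]
    refine zpow_eq_zpow_of_card_sub_one_dvd x ?_
    rw [hcard]
    refine ⟨w + v, ?_⟩
    push_cast [hq1]
    linear_combination hw + ((q : ℤ) - 1) * hv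
  have h2 : x ^ (d (j + 1) * q) =
      x ^ (Δ + (q - 1) * r : ℤ) * (x ^ ((q - 1) * h)) ^ (-(j : ℤ)) := by
    rw [← zpow_natCast x, ← zpow_natCast x, ← zpow_mul, ← zpow_add]
    refine zpow_eq_zpow_of_card_sub_one_dvd x ?_
    rw [hcard]
    refine ⟨q * w + s (j + 1) - u - v, ?_⟩
    push_cast [hq1]
    linear_combination (q : ℤ) * hw - ((q : ℤ) - 1) * hv - ((q : ℤ) - 1) * hu
  have h1' := congrArg Units.val h1
  have h2' := congrArg Units.val h2
  simp only [Units.val_mul, Units.val_pow_eq_pow_val, Units.val_zpow_eq_zpow_val] at h1' h2' ⊢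
  rw [h1', h2']
  ring

/-- The number of units at which `∑ a_j x ^ d_j` plus its conjugate vanishes. -/
lemma exists_card_sum_add_sum_pow_eq_zero {p m q : ℕ} [Fact p.Prime] (hq : q = p ^ m) {F : Type*}
    [Field F] [Fintype F] [DecidableEq F] [CharP F p] (hF : Fintype.card F = q ^ 2)
    {h Δ t : ℕ} {d : ℕ → ℕ} {s : ℕ → ℤ} {r : ℤ} (hr : (q : ℤ) + 1 ∣ 2 * r + h - Δ)
    (hs : ∀ j, 1 ≤ j → j ≤ t → (q : ℤ) + 1 ∣ s j - (j * h + r))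
    (hd : ∀ j, 1 ≤ j → j ≤ t →
      (d j : ℤ) ≡ s j * ((q : ℤ) - 1) + Δ [ZMOD ((q : ℤ) ^ 2 - 1)])
    {a : Fin t → F} (ha : a ≠ 0) :
    ∃ j ≤ 2 * t - 1, #{x : Fˣ | (∑ j : Fin t, a j * (x : F) ^ d (j + 1)) +
      (∑ j : Fin t, a j * (x : F) ^ d (j + 1)) ^ q = 0} = (q - 1) * h.gcd (q + 1) * j := by
  obtain ⟨P, hP0, hPdeg, hP⟩ := exists_polynomial_eval_eq_zero_iff q t ha
  obtain ⟨j, hj, hcount⟩ :=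
    exists_card_pow_mem_eq ((q - 1) * h) ({w : Fˣ | P.eval (w : F) = 0} : Finset Fˣ)
  refine ⟨j, hj.trans (le_trans ?_ hPdeg), ?_⟩
  · refine le_trans ?_ ((Multiset.toFinset_card_le P.roots).trans (card_roots' P))
    refine card_le_card_of_injOn Units.val (fun w hw => ?_) Units.val_injective.injOn
    simp only [coe_filter, mem_univ, true_and, Set.mem_ofPred_eq] at hw
    simpa [hP0] using hw
  · have hcard : Nat.card Fˣ = (q - 1) * (q + 1) := by
      rw [Nat.card_units, Nat.card_eq_fintype_card, hF, mul_comm, ← Nat.sq_sub_sq, one_pow]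
    rw [hcard, Nat.gcd_mul_left, Nat.gcd_comm] at hcount
    rw [← hcount]
    congr 1
    ext x
    simp only [mem_filter, mem_univ, true_and]
    rw [sum_add_sum_pow_eq hq hF hr hs hd, mul_eq_zero, or_iff_right (Units.ne_zero _),
      hP _ (Units.ne_zero _)]

/-- The weight of a word obtained by evaluating `f` at the powers of a primitive element. -/
lemma hammingNorm_eq_card_units {F R : Type*} [Field F] [Fintype F] [DecidableEq F] [Zero R]
    [DecidableEq R] {n : ℕ} (hn : Fintype.card F - 1 = n) {γ : Fˣ}
    (hγ : ∀ x : Fˣ, x ∈ Subgroup.zpowers γ) (f : Fˣ → R) :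
    hammingNorm (fun i : Fin n => f (γ ^ (i : ℕ))) = #{x | f x ≠ 0} := by
  have hord : orderOf γ = n := by
    rw [orderOf_eq_card_of_forall_mem_zpowers hγ, Nat.card_units, Nat.card_eq_fintype_card, hn]
  have hinj : Function.Injective fun i : Fin n => γ ^ (i : ℕ) := fun i j hij =>
    Fin.ext (pow_injOn_Iio_orderOf (by simp [hord]) (by simp [hord]) hij)
  have hbij := (Fintype.bijective_iff_injective_and_card _).2
    ⟨hinj, by rw [Fintype.card_fin, Fintype.card_units, hn]⟩
  unfold hammingNorm
  exact card_bijective _ hbij fun i => by simp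

/-- Theorem 1(ii), weight part: with the setup of the `p`-ary code `C⁽²⁾` (see the paper),
for every nonzero message `a = (a₁, …, a_t)` the Hamming weight of the codeword `c̃(a)`
equals `((p-1)/p)·(q² - (je-1)q)` for some `0 ≤ j ≤ 2t-1` (stated as
`p·wt(c̃(a)) = (p-1)(q² - (je-1)q)` over `ℤ`); in particular `C⁽²⁾` has at most `2t`
distinct nonzero weights. -/
theorem stmt_7 (p m : ℕ) (hp : p.Prime) (hm : 0 < m) (q : ℕ) (hq : q = p ^ m)
    (F : Type*) [Field F] [Fintype F] [Algebra (ZMod p) F]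
    (hF : Fintype.card F = q ^ 2)
    (γ : Fˣ) (hγ : ∀ x : Fˣ, x ∈ Subgroup.zpowers γ)
    (h Δ : ℕ) (hh : 0 < h) (hΔpos : 0 < Δ)
    (hhq : ¬ (q + 1) ∣ h) (hΔ : Nat.gcd Δ (q - 1) = 1)
    (hparity : p ≠ 2 → Odd Δ ∧ Odd h)
    (e : ℕ) (he : e = Nat.gcd h (q + 1))
    (t : ℕ) (ht1 : 1 ≤ t) (ht : 2 * e * t ≤ q + 1)
    (d : ℕ → ℕ) (s : ℕ → ℤ)
    (hdpos : ∀ j, 1 ≤ j → j ≤ t → 0 < d j)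
    (hs : ∀ j, 1 ≤ j → j ≤ t →
      2 * s j ≡ 2 * (j : ℤ) * h + ((Δ : ℤ) - h)
        [ZMOD (if p = 2 then (q : ℤ) + 1 else 2 * ((q : ℤ) + 1))])
    (hd : ∀ j, 1 ≤ j → j ≤ t →
      (d j : ℤ) ≡ s j * ((q : ℤ) - 1) + Δ [ZMOD ((q : ℤ) ^ 2 - 1)])
    (c : (Fin t → F) → Fin (q ^ 2 - 1) → ZMod p)
    (hc : ∀ a i, c a i =
      Algebra.trace (ZMod p) F
        (∑ j : Fin t, a j * (γ : F) ^ (d ((j : ℕ) + 1) * (i : ℕ)))) :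
    (∀ a : Fin t → F, a ≠ 0 → ∃ j : ℕ, j ≤ 2 * t - 1 ∧
      (p * hammingNorm (c a) : ℤ) = ((p : ℤ) - 1) * ((q : ℤ) ^ 2 - ((j : ℤ) * e - 1) * q)) ∧
    {w : ℕ | ∃ a : Fin t → F, a ≠ 0 ∧ hammingNorm (c a) = w}.ncard ≤ 2 * t := by
  classical
  subst he
  have := Fact.mk hp
  have : CharP F p := charP_of_injective_algebraMap (algebraMap (ZMod p) F).injective p
  have hq2 : 2 ≤ q := hq ▸ hp.two_le.trans (Nat.le_self_pow hm.ne' p)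
  have hweight : ∀ a : Fin t → F, a ≠ 0 → ∃ j : ℕ, j ≤ 2 * t - 1 ∧
      (p * hammingNorm (c a) : ℤ) =
        ((p : ℤ) - 1) * ((q : ℤ) ^ 2 - ((j : ℤ) * h.gcd (q + 1) - 1) * q) := by
    intro a ha
    obtain ⟨φ⟩ := exists_algHom_galoisField (p := p) hm (hF.trans (by rw [hq]))
    let : Algebra (GaloisField p m) F := φ.toRingHom.toAlgebra
    have : IsScalarTower (ZMod p) (GaloisField p m) F :=
      IsScalarTower.of_algebraMap_eq fun x => (φ.commutes x).symm
    let := Fintype.ofFinite (GaloisField p m)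
    have hK : Fintype.card (GaloisField p m) = q := by
      rw [← Nat.card_eq_fintype_card, GaloisField.card p m hm.ne', hq]
    obtain ⟨r, hr, hsr⟩ :=
      exists_half_shift (fun h2 => hq ▸ h2 ▸ even_two.pow_of_ne_zero hm.ne') hparity hs
    obtain ⟨j, hj, hzero⟩ := exists_card_sum_add_sum_pow_eq_zero hq hF hr hsr hd ha
    refine ⟨j, hj, ?_⟩
    have hnorm : hammingNorm (c a) = #{x : Fˣ | Algebra.trace (ZMod p) F
        (∑ j : Fin t, a j * (x : F) ^ d (j + 1)) ≠ 0} := by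
      rw [← hammingNorm_eq_card_units (by rw [hF]) hγ]
      congr 1
      ext i
      rw [hc]
      simp [← pow_mul, mul_comm]
    have havg := card_trace_ne_zero_of_homogeneous (p := p) (K := GaloisField p m)
      (by rw [hF, hK]) (Δ := Δ) (by rw [hK]; exact Nat.Coprime.symm hΔ)
      (fun x : Fˣ => ∑ j : Fin t, a j * (x : F) ^ d (j + 1)) (by
        intro y x
        rw [mul_sum]
        refine sum_congr rfl fun j _ => ?_
        have hy : y ^ d (j + 1) = y ^ Δ := by
          rw [← zpow_natCast y, ← zpow_natCast y]
          refine zpow_eq_zpow_of_card_sub_one_dvd y ?_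
          obtain ⟨w, hw⟩ := (hd (j + 1) (by omega) (by omega)).symm.dvd
          rw [hK]
          exact ⟨(q + 1) * w + s (j + 1), by linear_combination hw⟩
        have hy' : algebraMap (GaloisField p m) F y ^ d (j + 1) =
            algebraMap (GaloisField p m) F y ^ Δ := by
          simpa using congrArg (fun z : (GaloisField p m)ˣ => algebraMap (GaloisField p m) F z) hy
        simp only [Units.val_mul, mul_pow, Units.coe_map, MonoidHom.coe_coe, hy']
        ring)
    rw [← hnorm, hK] at havg
    have hsplit := card_filter_add_card_filter_not (s := (univ : Finset Fˣ))
      (fun x => (∑ j : Fin t, a j * (x : F) ^ d (j + 1)) +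
        (∑ j : Fin t, a j * (x : F) ^ d (j + 1)) ^ q = 0)
    rw [hzero, card_univ, Fintype.card_units, hF] at hsplit
    zify [one_le_two.trans hq2, Nat.one_le_pow 2 q (by omega)] at hsplit
    have hq0 : (q : ℤ) - 1 ≠ 0 := by omega
    refine mul_left_cancel₀ hq0 ?_
    linear_combination havg + ((p : ℤ) - 1) * q * hsplit
  refine ⟨hweight, ?_⟩
  let W : ℕ → ℤ := fun j =>
    ((p : ℤ) - 1) * ((q : ℤ) ^ 2 - ((j : ℤ) * h.gcd (q + 1) - 1) * q)
  have hsub : (fun w : ℕ => (p * w : ℤ)) '' {w | ∃ a : Fin t → F, a ≠ 0 ∧ hammingNorm (c a) = w} ⊆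
      ((range (2 * t)).image W : Finset ℤ) := by
    rintro _ ⟨_, ⟨a, ha, rfl⟩, rfl⟩
    obtain ⟨j, hj, hw⟩ := hweight a ha
    exact mem_coe.2 (mem_image.2 ⟨j, mem_range.2 (by omega), hw.symm⟩)
  have hinj : Function.Injective fun w : ℕ => (p * w : ℤ) := fun x y hxy => by
    simpa [hp.ne_zero] using hxy
  rw [← Set.ncard_image_of_injective _ hinj]
  refine (Set.ncard_le_ncard hsub (finite_toSet _)).trans ?_
  rw [Set.ncard_coe_finset]
  exact card_image_le.trans (card_range _).le
end

section
/- For a = (a_0, a_1, …, a_t) with a_0 ∈ F_q and a_1, …, a_t ∈ F_{q²}, define the exponential sum S(a) = Σ_{x ∈ F_{q²}} (−1)^{Tr_{q/2}(a_0 x^{d_0}) + Tr_{q²/2}(Σ_{j=1}^t a_j x^{d_j})}. If 0 ≤ t ≤ (q+1)/(2e), then S(0) = q², and for every nonzero a there exists an integer j with 0 ≤ j ≤ 2t such that S(a) = (je−1)q. -/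
open Polynomial in
/-- A Laurent-type polynomial of length `2t + 1`, shifted by `X ^ t`. -/
noncomputable def laurentShift {F : Type*} [Field F] {t : ℕ} (c : F) (a b : Fin t → F) : F[X] :=
  C c * X ^ t + ∑ j : Fin t, (C (a j) * X ^ (t + (j + 1)) + C (b j) * X ^ (t - (j + 1)))

open Polynomial in
theorem natDegree_laurentShift_le {F : Type*} [Field F] {t : ℕ} (c : F) (a b : Fin t → F) :
    (laurentShift c a b).natDegree ≤ 2 * t := by
  refine natDegree_add_le_of_degree_le ((natDegree_C_mul_X_pow_le _ _).trans (by omega)) ?_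
  refine natDegree_sum_le_of_forall_le _ _ fun j _ => ?_
  exact natDegree_add_le_of_degree_le ((natDegree_C_mul_X_pow_le _ _).trans (by omega))
    ((natDegree_C_mul_X_pow_le _ _).trans (by omega))

open Polynomial in
theorem laurentShift_ne_zero {F : Type*} [Field F] {t : ℕ} {c : F} {a : Fin t → F}
    (hca : c ≠ 0 ∨ a ≠ 0) (b : Fin t → F) : laurentShift c a b ≠ 0 := by
  intro h0
  rcases hca with hc | ha
  · apply hc
    have h1 := congrArg (fun p => p.coeff t) h0
    simp only [laurentShift, coeff_add, coeff_C_mul_X_pow, finsetSum_coeff, coeff_zero,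
      if_true] at h1
    rw [Finset.sum_eq_zero, add_zero] at h1
    · exact h1
    · intro j _
      rw [if_neg (by omega), if_neg (by have := j.2; omega), add_zero]
  · apply ha
    funext i
    have h1 := congrArg (fun p => p.coeff (t + (i + 1))) h0
    simp only [laurentShift, coeff_add, coeff_C_mul_X_pow, finsetSum_coeff, coeff_zero] at h1
    rw [if_neg (by omega), zero_add, Finset.sum_eq_single i] at h1
    · rwa [if_pos rfl, if_neg (by omega), add_zero] at h1
    · intro j _ hj
      rw [if_neg (by intro h; exact hj (Fin.ext (by omega))), if_neg (by omega), add_zero]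
    · simp

/-- In a finite cyclic group, a set of `n`-th powers pulls back along `x ↦ x ^ n` to a set
`gcd(|G|, n)` times as large. -/
theorem IsCyclic.card_filter_pow {G : Type*} [CommGroup G] [IsCyclic G] [Fintype G]
    [DecidableEq G] (n : ℕ) (P : G → Prop) [DecidablePred P] :
    (Finset.univ.filter fun x : G => P (x ^ n)).card =
      ((Finset.univ.image fun x : G => x ^ n).filter P).card * (Fintype.card G).gcd n := by
  rw [Finset.card_eq_sum_card_fiberwise (f := fun x : G => x ^ n)
    (t := (Finset.univ.image fun x : G => x ^ n).filter P) (by intro x hx; simpa using hx)]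
  refine Finset.sum_const_nat fun w hw => ?_
  simp only [Finset.mem_filter, Finset.mem_image, Finset.mem_univ, true_and] at hw
  rw [← Nat.card_eq_fintype_card, ← IsCyclic.card_powMonoidHom_ker, Nat.card_eq_fintype_card,
    Fintype.card_subtype]
  have hfib := MonoidHom.card_fiber_eq_of_mem_range (powMonoidHom n : G →* G)
    (x := w) (y := 1) (by simpa using hw.1) ⟨1, by simp⟩
  simp only [powMonoidHom_apply] at hfib
  rw [Finset.filter_filter]
  simp only [MonoidHom.mem_ker, powMonoidHom_apply]
  convert! hfib using 2
  ext x
  simp only [Finset.mem_filter, Finset.mem_univ, true_and, and_iff_right_iff_imp]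
  rintro rfl
  exact hw.2

/-- The sign character `x ↦ (-1) ^ Tr x` of a finite field of characteristic two. -/
noncomputable def traceSign (K : Type*) [Field K] [Algebra (ZMod 2) K] : AddChar K ℤ :=
  (AddChar.zmodChar 2 (ζ := (-1 : ℤ)) (by norm_num)).compAddMonoidHom
    (Algebra.trace (ZMod 2) K).toAddMonoidHom

theorem traceSign_apply {K : Type*} [Field K] [Algebra (ZMod 2) K] (x : K) :
    traceSign K x = (-1 : ℤ) ^ (Algebra.trace (ZMod 2) K x).val := rfl

theorem traceSign_isPrimitive (K : Type*) [Field K] [Finite K] [Algebra (ZMod 2) K] :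
    (traceSign K).IsPrimitive := by
  apply AddChar.IsPrimitive.of_ne_one
  obtain ⟨x, hx⟩ := Algebra.trace_surjective (ZMod 2) K 1
  refine AddChar.ne_one_iff.2 ⟨x, ?_⟩
  rw [traceSign_apply, hx]
  decide

/-- If the `L x` scale by a permutation of `K` under multiplication of `x` by scalars from `K`, the
sum of `traceSign K (L x)` is determined by the number of zeros of `L`. -/
theorem card_mul_sum_traceSign {K F : Type*} [Field K] [Fintype K] [Field F] [Fintype F]
    [DecidableEq K] [Algebra (ZMod 2) K] [Algebra K F] (L : F → K) (n : ℕ) (hn : n ≠ 0)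
    (hbij : Function.Bijective fun y : K => y ^ n)
    (hL : ∀ (y : K) (x : F), L (algebraMap K F y * x) = y ^ n * L x) :
    ((Fintype.card K : ℤ) - 1) * ∑ x : F, traceSign K (L x) + Fintype.card F =
      Fintype.card K * (Finset.univ.filter fun x : F => L x = 0).card := by
  have hrow : ∑ y : K, ∑ x : F, traceSign K (L (algebraMap K F y * x)) =
      ((Fintype.card K : ℤ) - 1) * ∑ x : F, traceSign K (L x) + Fintype.card F := by
    rw [← Finset.add_sum_erase _ _ (Finset.mem_univ (0 : K)), add_comm]
    congr 1
    · rw [Finset.sum_congr rfl (g := fun _ => ∑ x : F, traceSign K (L x))]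
      · rw [Finset.sum_const, Finset.card_erase_of_mem (Finset.mem_univ _), Finset.card_univ,
          nsmul_eq_mul, Nat.cast_sub Fintype.card_pos, Nat.cast_one]
      · intro y hy
        exact Fintype.sum_equiv (Equiv.mulLeft₀ (algebraMap K F y)
          (by simpa using hy)) _ _ fun x => rfl
    · have h0 : L 0 = 0 := by simpa [hn] using hL 0 0
      simp [h0]
  have hcol : ∀ x : F, ∑ y : K, traceSign K (L (algebraMap K F y * x)) =
      if L x = 0 then (Fintype.card K : ℤ) else 0 := by
    intro x
    have h := AddChar.sum_mulShift (L x) (traceSign_isPrimitive K)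
    simp only [hL]
    rw [hbij.sum_comp (fun y => traceSign K (y * L x)), h]
    split_ifs <;> simp
  rw [← hrow, Finset.sum_comm, Finset.sum_congr rfl fun x _ => hcol x, ← Finset.sum_filter,
    Finset.sum_const, nsmul_eq_mul, mul_comm]

theorem Nat.gcd_mul_pred_sq_sub_one (q h : ℕ) :
    (q ^ 2 - 1).gcd (h * (q - 1)) = Nat.gcd h (q + 1) * (q - 1) := by
  have : q ^ 2 - 1 = (q + 1) * (q - 1) := by simpa using Nat.sq_sub_sq q 1
  rw [this, Nat.gcd_mul_right, Nat.gcd_comm]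

/-- Niho exponents are congruent to an arithmetic progression with difference `h * (q - 1)`. -/
theorem niho_modEq {q h Δ d₀ d j : ℕ} {s₀ s : ℤ} (hq : 1 ≤ q) (heven : Even q)
    (hs₀ : 2 * s₀ ≡ Δ [ZMOD ((q : ℤ) + 1)])
    (hs : 2 * s ≡ 2 * (j : ℤ) * h + Δ [ZMOD ((q : ℤ) + 1)])
    (hd₀ : (d₀ : ℤ) ≡ s₀ * ((q : ℤ) - 1) + Δ [ZMOD ((q : ℤ) ^ 2 - 1)])
    (hd : (d : ℤ) ≡ s * ((q : ℤ) - 1) + Δ [ZMOD ((q : ℤ) ^ 2 - 1)]) :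
    d ≡ d₀ + h * (q - 1) * j [MOD (q ^ 2 - 1)] := by
  have h2 : 2 * (s - s₀) ≡ 2 * ((j : ℤ) * h) [ZMOD ((q : ℤ) + 1)] := by
    have := hs.sub hs₀
    ring_nf at this ⊢
    exact this
  have h1 : s - s₀ ≡ (j : ℤ) * h [ZMOD ((q : ℤ) + 1)] := by
    obtain ⟨k, rfl⟩ := heven
    refine Int.ModEq.symm ((Int.modEq_iff_dvd).2 ?_)
    have := (Int.modEq_iff_dvd).1 h2.symm
    rw [← mul_sub] at this
    refine IsCoprime.dvd_of_dvd_mul_left ⟨1, -(k : ℤ), ?_⟩ this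
    push_cast
    ring
  have h3 : (s - s₀) * ((q : ℤ) - 1) ≡ (j : ℤ) * h * ((q : ℤ) - 1) [ZMOD ((q : ℤ) ^ 2 - 1)] := by
    have := h1.mul_right' (c := (q : ℤ) - 1)
    convert this using 1
    ring
  have hq2 : 1 ≤ q ^ 2 := Nat.one_le_pow _ _ hq
  rw [← Int.natCast_modEq_iff]
  push_cast [hq, hq2]
  rw [show s * ((q : ℤ) - 1) + Δ = s₀ * ((q : ℤ) - 1) + Δ + (s - s₀) * ((q : ℤ) - 1) by ring] at hd
  rw [show (d₀ : ℤ) + h * ((q : ℤ) - 1) * j = d₀ + (j : ℤ) * h * ((q : ℤ) - 1) by ring]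
  exact hd.trans (hd₀.symm.add h3)

theorem pow_eq_pow_of_modEq_card_sub_one {K : Type*} [Field K] [Fintype K] {a b : ℕ}
    (ha : a ≠ 0) (hb : b ≠ 0) (hab : a ≡ b [MOD (Fintype.card K - 1)]) (y : K) :
    y ^ a = y ^ b := by
  rcases eq_or_ne y 0 with rfl | hy
  · rw [zero_pow ha, zero_pow hb]
  · exact pow_eq_pow_of_modEq hab (FiniteField.pow_card_sub_one_eq_one y hy)

theorem FiniteField.pow_bijective_of_coprime {K : Type*} [Field K] [Fintype K] {n : ℕ}
    (hn : n ≠ 0) (hcop : n.gcd (Fintype.card K - 1) = 1) :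
    Function.Bijective fun y : K => y ^ n := by
  classical
  refine Finite.injective_iff_bijective.1 fun y z hyz => ?_
  change y ^ n = z ^ n at hyz
  rcases eq_or_ne y 0 with rfl | hy
  · rw [zero_pow hn] at hyz
    exact (eq_zero_of_pow_eq_zero hyz.symm).symm
  rcases eq_or_ne z 0 with rfl | hz
  · rw [zero_pow hn] at hyz
    exact eq_zero_of_pow_eq_zero hyz
  have hc : (Nat.card Kˣ).Coprime n := by
    rw [Nat.card_eq_fintype_card, Fintype.card_units]
    exact Nat.Coprime.symm hcop
  have : Units.mk0 y hy = Units.mk0 z hz := by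
    apply (powCoprime hc).injective
    ext
    simpa using hyz
  exact congrArg Units.val this

theorem card_filter_eq_card_units_add_one {F : Type*} [Field F] [Fintype F] [DecidableEq F]
    (P : F → Prop) [DecidablePred P] (h0 : P 0) :
    (Finset.univ.filter P).card = (Finset.univ.filter fun u : Fˣ => P u).card + 1 := by
  rw [← Finset.card_erase_add_one (a := (0 : F)) (by simpa using h0)]
  congr 1
  symm
  refine Finset.card_bij (fun u _ => (u : F)) ?_ (fun u _ v _ h => Units.ext h) ?_
  · intro u hu
    simpa using hu
  · intro x hx
    simp only [Finset.mem_erase, Finset.mem_filter, Finset.mem_univ, true_and] at hx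
    exact ⟨Units.mk0 x hx.1, by simpa using hx.2, rfl⟩

/-- The trace of a quadratic extension of finite fields. -/
theorem algebraMap_trace_eq_add_pow {K F : Type*} [Field K] [Fintype K] [Field F] [Fintype F]
    [Algebra K F] {q : ℕ} (hK : Fintype.card K = q) (hF : Fintype.card F = q ^ 2) (z : F) :
    algebraMap K F (Algebra.trace K F z) = z + z ^ q := by
  have hr : Module.finrank K F = 2 := by
    have h := Module.card_eq_pow_finrank (K := K) (V := F)
    rw [hF, hK] at h
    exact (Nat.pow_right_injective (hK ▸ Fintype.one_lt_card : 2 ≤ q) h).symm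
  rw [FiniteField.algebraMap_trace_eq_sum_pow, hr, Finset.sum_range_succ, Finset.sum_range_one,
    Nat.card_eq_fintype_card, hK, pow_zero, pow_one, pow_one]

open Polynomial in
/-- On the norm-one group, `laurentShift c a (a ^ q)` is `w ^ t` times a trace form. -/
theorem eval_laurentShift {F : Type*} [Field F] {t q : ℕ} (c : F) (a : Fin t → F) {w : F}
    (hw : w ^ (q + 1) = 1) :
    (laurentShift c a fun j => a j ^ q).eval w =
      w ^ t * (c + ∑ j : Fin t, (a j * w ^ ((j : ℕ) + 1) + (a j * w ^ ((j : ℕ) + 1)) ^ q)) := by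
  rw [laurentShift, eval_add, eval_finsetSum, mul_add, Finset.mul_sum]
  congr 1
  · rw [eval_mul, eval_C, eval_pow, eval_X, mul_comm]
  · refine Finset.sum_congr rfl fun j _ => ?_
    have h1 : w ^ t * (w ^ ((j : ℕ) + 1)) ^ q = w ^ (t - (j + 1)) := by
      rw [← pow_sub_mul_pow w (show (j : ℕ) + 1 ≤ t by omega), mul_assoc, ← pow_succ', ← pow_mul, mul_comm ((j : ℕ) + 1), pow_mul, hw, one_pow, mul_one]
    simp only [eval_add, eval_mul, eval_C, eval_pow, eval_X]
    rw [mul_pow, ← h1]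
    ring

/-- The key exponential-sum evaluation behind Theorem 1(i): with `p = 2`, `q = 2^m`, `K` the
subfield with `q` elements of the field `F` with `q²` elements, and Niho-type exponents
`d_0, …, d_t` as in the paper (so that `x^{d_0} ∈ K` for all `x ∈ F`, witnessed by
`g : F → K`), define `S(a) = ∑_{x ∈ F_{q²}} (-1)^{Tr_{q/2}(a₀ x^{d₀}) + Tr_{q²/2}(∑_j a_j x^{d_j})}`.
If `0 ≤ t ≤ (q+1)/(2e)`, then `S(0) = q²` and for every nonzero `a` there exists
`0 ≤ j ≤ 2t` with `S(a) = (je - 1)q`. -/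
theorem stmt_8 (m : ℕ) (hm : 0 < m) (q : ℕ) (hq : q = 2 ^ m)
    (K F : Type*) [Field K] [Fintype K] [Field F] [Fintype F]
    [Algebra (ZMod 2) K] [Algebra (ZMod 2) F] [Algebra K F]
    [IsScalarTower (ZMod 2) K F]
    (hK : Fintype.card K = q) (hF : Fintype.card F = q ^ 2)
    (γ : Fˣ) (hγ : ∀ x : Fˣ, x ∈ Subgroup.zpowers γ)
    (h Δ : ℕ) (hh : 0 < h) (hΔpos : 0 < Δ)
    (hhq : ¬ (q + 1) ∣ h) (hΔ : Nat.gcd Δ (q - 1) = 1)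
    (e : ℕ) (he : e = Nat.gcd h (q + 1))
    (t : ℕ) (ht : 2 * e * t ≤ q + 1)
    (d : ℕ → ℕ) (s : ℕ → ℤ)
    (hdpos : ∀ j ≤ t, 0 < d j)
    (hs : ∀ j ≤ t, 2 * s j ≡ 2 * (j : ℤ) * h + Δ [ZMOD ((q : ℤ) + 1)])
    (hd : ∀ j ≤ t, (d j : ℤ) ≡ s j * ((q : ℤ) - 1) + Δ [ZMOD ((q : ℤ) ^ 2 - 1)])
    (g : F → K) (hg : ∀ x : F, algebraMap K F (g x) = x ^ d 0)
    (S : K × (Fin t → F) → ℤ)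
    (hS : ∀ a, S a = ∑ x : F, (-1 : ℤ) ^
      (Algebra.trace (ZMod 2) K (a.1 * g x) +
        Algebra.trace (ZMod 2) F
          (∑ j : Fin t, a.2 j * x ^ d ((j : ℕ) + 1))).val) :
    S 0 = (q : ℤ) ^ 2 ∧
    ∀ a : K × (Fin t → F), a ≠ 0 → ∃ j : ℕ, j ≤ 2 * t ∧
      S a = ((j : ℤ) * e - 1) * q := by
  classical
  have hq1 : 1 ≤ q := hq ▸ Nat.one_le_two_pow
  have heven : Even q := hq ▸ (Nat.even_pow.2 ⟨even_two, hm.ne'⟩)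
  have hq2 : 2 ≤ q := by rw [← hK]; exact Fintype.one_lt_card
  have hdvd : q - 1 ∣ q ^ 2 - 1 := by
    rw [show q ^ 2 - 1 = (q + 1) * (q - 1) by simpa using Nat.sq_sub_sq q 1]
    exact dvd_mul_left _ _
  have hmod : ∀ j ≤ t, d j ≡ d 0 + h * (q - 1) * j [MOD (q ^ 2 - 1)] := fun j hj =>
    niho_modEq hq1 heven (by simpa using hs 0 t.zero_le) (hs j hj) (hd 0 t.zero_le) (hd j hj)
  have hcard : Fintype.card K - 1 = q - 1 := by rw [hK]
  have hpowK : ∀ j ≤ t, ∀ y : K, y ^ d j = y ^ d 0 := by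
    intro j hj y
    refine pow_eq_pow_of_modEq_card_sub_one (hdpos j hj).ne' (hdpos 0 t.zero_le).ne' ?_ y
    rw [hcard]
    refine ((hmod j hj).of_dvd hdvd).trans ?_
    simp [Nat.ModEq, mul_right_comm]
  have hd0 : d 0 ≡ Δ [MOD (q - 1)] := by
    rw [← Int.natCast_modEq_iff]
    push_cast [hq1]
    refine ((hd 0 t.zero_le).of_dvd ⟨(q : ℤ) + 1, by ring⟩).trans ?_
    simp [Int.ModEq]
  have hbij : Function.Bijective fun y : K => y ^ d 0 := by
    refine FiniteField.pow_bijective_of_coprime (hdpos 0 t.zero_le).ne' ?_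
    rw [hcard]
    exact hd0.gcd_eq.trans hΔ
  let L : K × (Fin t → F) → F → K := fun a x =>
    a.1 * g x + Algebra.trace K F (∑ j : Fin t, a.2 j * x ^ d ((j : ℕ) + 1))
  have hSL : ∀ a, S a = ∑ x : F, traceSign K (L a x) := by
    intro a
    rw [hS]
    refine Finset.sum_congr rfl fun x _ => ?_
    rw [traceSign_apply, map_add, Algebra.trace_trace]
  have hgmul : ∀ (y : K) (x : F), g (algebraMap K F y * x) = y ^ d 0 * g x := by
    intro y x
    apply (algebraMap K F).injective
    rw [hg, map_mul, hg, mul_pow, map_pow]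
  have hL : ∀ a (y : K) (x : F), L a (algebraMap K F y * x) = y ^ d 0 * L a x := by
    intro a y x
    simp only [L]
    rw [hgmul, mul_add, ← smul_eq_mul (y ^ d 0) (Algebra.trace K F _), ← map_smul, Finset.smul_sum,
      mul_left_comm]
    congr 3
    funext j
    rw [mul_pow, ← map_pow, hpowK _ (by omega), Algebra.smul_def, mul_left_comm]
  refine ⟨?_, fun a ha => ?_⟩
  · rw [hSL]
    simp [L, hF]
  have hUcard : Fintype.card Fˣ = q ^ 2 - 1 := by rw [Fintype.card_units, hF]
  have hcyc : IsCyclic Fˣ := ⟨γ, hγ⟩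
  let p : Polynomial F := laurentShift (algebraMap K F a.1) a.2 fun j => a.2 j ^ q
  have hp : p ≠ 0 := by
    refine laurentShift_ne_zero ?_ _
    by_contra! hcon
    exact ha (Prod.ext (by simpa using hcon.1) hcon.2)
  have hLp : ∀ u : Fˣ, L a u = 0 ↔ p.IsRoot ((u ^ (h * (q - 1)) : Fˣ) : F) := by
    intro u
    set w : F := ((u ^ (h * (q - 1)) : Fˣ) : F) with hw
    have hw1 : w ^ (q + 1) = 1 := by
      rw [hw, ← Units.val_pow_eq_pow_val, ← pow_mul, mul_assoc,
        show (q - 1) * (q + 1) = Fintype.card Fˣ by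
          rw [hUcard, mul_comm]; simpa using (Nat.sq_sub_sq q 1).symm,
        mul_comm, pow_mul, pow_card_eq_one, one_pow, Units.val_one]
    have hu : ∀ j : Fin t, (u : F) ^ d ((j : ℕ) + 1) = (u : F) ^ d 0 * w ^ ((j : ℕ) + 1) := by
      intro j
      rw [hw, ← Units.val_pow_eq_pow_val, ← Units.val_pow_eq_pow_val, ← Units.val_pow_eq_pow_val,
        ← Units.val_mul, ← pow_mul, ← pow_add]
      congr 1
      refine pow_eq_pow_of_modEq (hmod _ (by omega)) ?_
      rw [← hUcard, pow_card_eq_one]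
    have hfix : ((u : F) ^ d 0) ^ q = (u : F) ^ d 0 := by
      rw [← hg, ← map_pow, ← hK, FiniteField.pow_card]
    have hLu : algebraMap K F (L a u) = (u : F) ^ d 0 * (algebraMap K F a.1 +
        ∑ j : Fin t, (a.2 j * w ^ ((j : ℕ) + 1) + (a.2 j * w ^ ((j : ℕ) + 1)) ^ q)) := by
      simp only [L]
      rw [map_add, map_mul, hg, map_sum, map_sum, mul_add, mul_comm, Finset.mul_sum]
      congr 1
      refine Finset.sum_congr rfl fun j _ => ?_
      rw [algebraMap_trace_eq_add_pow hK hF, hu, mul_left_comm, mul_pow, hfix, mul_add]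
    have hw0 : w ≠ 0 := Units.ne_zero _
    rw [← map_eq_zero (algebraMap K F), hLu, Polynomial.IsRoot.def, eval_laurentShift _ _ hw1,
      mul_eq_zero, mul_eq_zero, or_iff_right (pow_ne_zero _ u.ne_zero),
      or_iff_right (pow_ne_zero _ hw0)]
  let M := ((Finset.univ.image fun u : Fˣ => u ^ (h * (q - 1))).filter
    fun u : Fˣ => p.IsRoot (u : F)).card
  have hM : M ≤ 2 * t := by
    refine le_trans ?_ (natDegree_laurentShift_le (algebraMap K F a.1) a.2 fun j => a.2 j ^ q)
    simp only [M]
    rw [← Finset.card_map ⟨Units.val, Units.val_injective⟩]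
    refine Polynomial.card_le_degree_of_subset_roots (p := p) fun x hx => ?_
    simp only [Finset.mem_val, Finset.mem_map, Finset.mem_filter] at hx
    obtain ⟨u, hu, rfl⟩ := hx
    exact (Polynomial.mem_roots hp).2 hu.2
  refine ⟨M, hM, ?_⟩
  have hL0 : L a 0 = 0 := by
    simpa [(hdpos 0 t.zero_le).ne'] using hL a 0 0
  have hsum := card_mul_sum_traceSign (L a) (d 0) (hdpos 0 t.zero_le).ne' hbij (hL a)
  rw [← hSL, hK, hF, card_filter_eq_card_units_add_one (fun x => L a x = 0) hL0] at hsum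
  simp only [hLp] at hsum
  rw [IsCyclic.card_filter_pow (h * (q - 1)) fun u : Fˣ => p.IsRoot (u : F), hUcard,
    Nat.gcd_mul_pred_sq_sub_one, ← he] at hsum
  push_cast [hq1] at hsum
  have hne : (q : ℤ) - 1 ≠ 0 := by omega
  apply mul_left_cancel₀ hne
  linear_combination hsum
end

section
/- For a = (a_1, …, a_t) ∈ (F_{q²})^t, define the exponential sum S̃(a) = (p−1) + Σ_{λ ∈ F_p^*} Σ_{x ∈ F_{q²}^*} ζ_p^{Tr_{q²/p}(λ Σ_{j=1}^t a_j x^{d̃_j})}, where ζ_p = exp(2π√(−1)/p). If 1 ≤ t ≤ (q+1)/(2e), then S̃(0) = (p−1)q², and for every nonzero a there exists an integer j with 0 ≤ j ≤ 2t−1 such that S̃(a) = (je−1)q(p−1). -/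
/-- The trace to the prime field of `z ∈ 𝔽_{q²}` depends only on the relative trace `z + z ^ q`. -/
lemma algebraMap_trace_eq_sum_add_pow {p m : ℕ} [Fact p.Prime] {F : Type*} [Field F] [Fintype F]
    [Algebra (ZMod p) F] (hF : Fintype.card F = (p ^ m) ^ 2) (z : F) :
    algebraMap (ZMod p) F (Algebra.trace (ZMod p) F z) =
      ∑ i ∈ Finset.range m, (z + z ^ p ^ m) ^ p ^ i := by
  have : CharP F p := charP_of_injective_algebraMap (algebraMap (ZMod p) F).injective p
  have hfin : Module.finrank (ZMod p) F = m + m := by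
    have h1 := Module.card_eq_pow_finrank (K := ZMod p) (V := F)
    rw [hF, ZMod.card, ← pow_mul] at h1
    have := Nat.pow_right_injective (Fact.out : p.Prime).two_le h1
    omega
  rw [FiniteField.algebraMap_trace_eq_sum_pow, hfin, Nat.card_zmod, Finset.sum_range_add,
    ← Finset.sum_add_distrib]
  refine Finset.sum_congr rfl fun i _ => ?_
  rw [add_pow_char_pow, ← pow_mul, ← pow_add]

/-- The elements fixed by the `q`-power map, `q = p ^ m`. -/
def frobeniusFixedSubfield (p m : ℕ) [Fact p.Prime] (F : Type*) [Field F] [CharP F p] :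
    Subfield F :=
  (iterateFrobenius F p m).eqLocusField (RingHom.id F)

lemma mem_frobeniusFixedSubfield {p m : ℕ} [Fact p.Prime] {F : Type*} [Field F] [CharP F p]
    {x : F} : x ∈ frobeniusFixedSubfield p m F ↔ x ^ p ^ m = x := by
  rw [frobeniusFixedSubfield, RingHom.mem_eqLocusField, iterateFrobenius_def, RingHom.id_apply]

lemma trace_mul_frobeniusFixed_eq_zero_iff {p m : ℕ} [Fact p.Prime] {F : Type*} [Field F]
    [Fintype F] [Algebra (ZMod p) F] [CharP F p] (hF : Fintype.card F = (p ^ m) ^ 2) (z : F) :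
    (∀ k ∈ frobeniusFixedSubfield p m F, Algebra.trace (ZMod p) F (k * z) = 0) ↔
      z + z ^ p ^ m = 0 := by
  have hqq : ∀ y : F, (y ^ p ^ m) ^ p ^ m = y := fun y => by
    rw [← pow_mul, ← sq, ← hF, FiniteField.pow_card]
  have hinj := (algebraMap (ZMod p) F).injective
  constructor
  · intro hz
    have hfrob : ∀ y : F, Algebra.trace (ZMod p) F (y ^ p ^ m) = Algebra.trace (ZMod p) F y := by
      intro y
      apply hinj
      rw [algebraMap_trace_eq_sum_add_pow hF, algebraMap_trace_eq_sum_add_pow hF, hqq, add_comm]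
    refine (traceForm_nondegenerate (ZMod p) F).1 _ fun x => ?_
    have hx := hz (x + x ^ p ^ m)
      (mem_frobeniusFixedSubfield.2 (by rw [add_pow_char_pow, hqq, add_comm]))
    rw [Algebra.traceForm_apply, ← hx, add_mul, add_mul, map_add, map_add,
      ← hfrob (x ^ p ^ m * z), mul_pow, hqq, mul_comm x z, mul_comm x]
  · intro hz k hk
    apply hinj
    rw [algebraMap_trace_eq_sum_add_pow hF, mul_pow, mem_frobeniusFixedSubfield.1 hk, ← mul_add,
      hz, map_zero]
    exact Finset.sum_eq_zero fun i _ => by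
      rw [mul_zero, zero_pow (pow_ne_zero _ (Fact.out : p.Prime).ne_zero)]

lemma card_units_frobeniusFixedSubfield {p m : ℕ} [Fact p.Prime] {F : Type*} [Field F]
    [Fintype F] [CharP F p] (hm : 0 < m) (hF : Fintype.card F = (p ^ m) ^ 2) :
    Nat.card (frobeniusFixedSubfield p m F)ˣ = p ^ m - 1 := by
  set K := frobeniusFixedSubfield p m F
  have hq : 1 < p ^ m := Nat.one_lt_pow hm.ne' (Fact.out : p.Prime).one_lt
  have hker : (Units.map (K.subtype : K →* F)).range =
      (powMonoidHom (p ^ m - 1) : Fˣ →* Fˣ).ker := by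
    ext u
    have hu : (u : F) ∈ K ↔ u ^ (p ^ m - 1) = 1 := by
      rw [mem_frobeniusFixedSubfield, ← Units.val_inj, Units.val_pow_eq_pow_val, Units.val_one]
      conv_lhs => rw [← Nat.sub_add_cancel hq.le, pow_succ]
      exact mul_eq_right₀ u.ne_zero
    rw [MonoidHom.mem_ker, powMonoidHom_apply, ← hu]
    constructor
    · rintro ⟨k, rfl⟩
      exact k.1.2
    · intro hmem
      exact ⟨Units.mk0 ⟨u, hmem⟩ fun h0 => u.ne_zero (congrArg Subtype.val h0), by ext; rfl⟩
  have hinj : Function.Injective (Units.map (K.subtype : K →* F)) :=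
    Units.map_injective K.subtype.injective
  rw [Nat.card_congr (MonoidHom.ofInjective hinj).toEquiv, hker, IsCyclic.card_powMonoidHom_ker,
    Nat.card_units, Nat.card_eq_fintype_card, hF]
  exact Nat.gcd_eq_right ⟨p ^ m + 1, by
    rw [mul_comm, ← Nat.sq_sub_sq, one_pow]⟩

lemma card_frobeniusFixedSubfield {p m : ℕ} [Fact p.Prime] {F : Type*} [Field F]
    [Fintype F] [CharP F p] (hm : 0 < m) (hF : Fintype.card F = (p ^ m) ^ 2) :
    Nat.card (frobeniusFixedSubfield p m F) = p ^ m := by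
  have h1 := card_units_frobeniusFixedSubfield hm hF
  have hpos : 0 < Nat.card (frobeniusFixedSubfield p m F) := Nat.card_pos
  have hq : 1 < p ^ m := Nat.one_lt_pow hm.ne' (Fact.out : p.Prime).one_lt
  rw [Nat.card_units] at h1
  omega

/-- Orthogonality over the nonzero scalars of a finite subfield. -/
lemma sum_units_addChar_mul {F : Type*} [Field F] (K : Subfield F) [Fintype K] [DecidableEq K]
    (ψ : AddChar F ℂ) (z : F) [Decidable (∀ k ∈ K, ψ (k * z) = 1)] :
    ∑ k : Kˣ, ψ (((k : K) : F) * z) =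
      (if ∀ k ∈ K, ψ (k * z) = 1 then (Nat.card K : ℂ) else 0) - 1 := by
  classical
  let χ : AddChar K ℂ :=
    { toFun := fun k => ψ ((k : F) * z)
      map_zero_eq_one' := by simp
      map_add_eq_mul' := fun a b => by
        rw [Subfield.coe_add, add_mul, AddChar.map_add_eq_mul] }
  have hχ : χ = 0 ↔ ∀ k ∈ K, ψ (k * z) = 1 := by
    rw [AddChar.ext_iff]
    exact ⟨fun h k hk => h ⟨k, hk⟩, fun h k => h k k.2⟩
  have hsum := AddChar.sum_eq_ite χ
  rw [Fintype.sum_eq_add_sum_subtype_ne _ (0 : K), AddChar.map_zero_eq_one] at hsum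
  have hun : ∑ k : Kˣ, ψ (((k : K) : F) * z) = ∑ k : {k : K // k ≠ 0}, χ k :=
    Fintype.sum_equiv unitsEquivNeZero _ _ fun _ => rfl
  rw [hun, eq_sub_iff_add_eq', hsum, Nat.card_eq_fintype_card]
  simp only [hχ]

/-- A character sum of a function homogeneous of degree prime to `q - 1` over a subfield of order
`q` only depends on the number of points whose value lies in the annihilator of the subfield. -/
lemma card_mul_sum_addChar_of_homogeneous {F : Type*} [Field F] [Fintype F] [DecidableEq F]
    (K : Subfield F) (ψ : AddChar F ℂ) (f : Fˣ → F) {Δ : ℕ} (hΔ : (Nat.card Kˣ).Coprime Δ)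
    (hf : ∀ (k : Kˣ) (x : Fˣ),
      f (Units.map (K.subtype : K →* F) k * x) = ((k : K) : F) ^ Δ * f x)
    [DecidablePred fun x => ∀ k ∈ K, ψ (k * f x) = 1] :
    (Nat.card Kˣ : ℂ) * ∑ x, ψ (f x) =
      Nat.card K * (Finset.univ.filter fun x => ∀ k ∈ K, ψ (k * f x) = 1).card
        - Nat.card Fˣ := by
  classical
  have : Fintype K := Fintype.ofFinite K
  have hshift : ∀ k : Kˣ, ∑ x, ψ (f x) = ∑ x, ψ (((k : K) : F) ^ Δ * f x) := fun k => by
    simp only [← hf]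
    exact (Equiv.sum_comp (Equiv.mulLeft _) fun x => ψ (f x)).symm
  calc (Nat.card Kˣ : ℂ) * ∑ x, ψ (f x)
      = ∑ k : Kˣ, ∑ x, ψ (((k : K) : F) ^ Δ * f x) := by
        rw [← Finset.sum_congr rfl fun k _ => hshift k, Finset.sum_const, nsmul_eq_mul,
          Finset.card_univ, Nat.card_eq_fintype_card]
    _ = ∑ x, ∑ k : Kˣ, ψ (((k : K) : F) * f x) := by
        rw [Finset.sum_comm]
        refine Finset.sum_congr rfl fun x _ => ?_
        rw [← Equiv.sum_comp (powCoprime hΔ) fun k : Kˣ => ψ (((k : K) : F) * f x)]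
        simp
    _ = _ := by
        simp only [sum_units_addChar_mul]
        rw [Finset.sum_sub_distrib, ← Finset.sum_filter]
        simp only [Finset.sum_const, nsmul_eq_mul, mul_one, Finset.card_univ,
          Nat.card_eq_fintype_card]
        rw [mul_comm]

/-- The preimage of a set under an endomorphism of a finite group is a union of cosets of the
kernel. -/
lemma card_filter_monoidHom {G : Type*} [Group G] [Fintype G] [DecidableEq G] (φ : G →* G)
    (P : G → Prop) [DecidablePred P] :
    (Finset.univ.filter fun x => P (φ x)).card =
      Nat.card φ.ker * ((Finset.univ.image φ).filter P).card := by
  rw [Finset.card_eq_sum_card_fiberwise (f := φ) (t := (Finset.univ.image φ).filter P), mul_comm,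
    ← smul_eq_mul]
  · refine Finset.sum_const_nat fun v hv => ?_
    rw [Finset.mem_filter, Finset.mem_image] at hv
    obtain ⟨⟨x, -, hx⟩, hPv⟩ := hv
    have h1 := MonoidHom.card_fiber_eq_of_mem_range φ (x := v) (y := 1) ⟨x, hx⟩ ⟨1, map_one φ⟩
    have h2 : (Finset.univ.filter fun g => φ g = 1).card = Nat.card φ.ker := by
      rw [← Nat.subtype_card (Finset.univ.filter fun g => φ g = 1)]
      simp [MonoidHom.mem_ker]
    rw [← h2, ← h1, Finset.filter_filter]
    congr 1
    ext g
    simp only [Finset.mem_filter, Finset.mem_univ, true_and]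
    exact ⟨fun h => h.2, fun h => ⟨h ▸ hPv, h⟩⟩
  · intro x hx
    simpa using hx

open Polynomial in
/-- The polynomial whose unit-circle roots are counted by the Niho-type argument. -/
noncomputable def nihoPolynomial {F : Type*} [Field F] {t : ℕ} (q : ℕ) (a : Fin t → F) : F[X] :=
  ∑ i : Fin t, (C (a i) * X ^ (t + i) + C (a i ^ q) * X ^ (t - 1 - i))

lemma nihoPolynomial_ne_zero {F : Type*} [Field F] {t : ℕ} (q : ℕ) {a : Fin t → F} (ha : a ≠ 0) :
    nihoPolynomial q a ≠ 0 := by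
  obtain ⟨i, hi⟩ := Function.ne_iff.1 ha
  intro h0
  apply hi
  have h1 := congrArg (fun P => Polynomial.coeff P (t + i)) h0
  simp only [nihoPolynomial, Polynomial.finsetSum_coeff, Polynomial.coeff_add,
    Polynomial.coeff_C_mul, Polynomial.coeff_X_pow, Polynomial.coeff_zero] at h1
  rw [Finset.sum_eq_single i] at h1
  · rw [if_pos rfl, if_neg (by omega)] at h1
    simpa using h1
  · intro b _ hb
    have hb' : (b : ℕ) ≠ i := fun h => hb (Fin.ext h)
    rw [if_neg (by omega), if_neg (by omega)]
    simp
  · simp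

lemma natDegree_nihoPolynomial_le {F : Type*} [Field F] {t : ℕ} (q : ℕ) (a : Fin t → F) :
    (nihoPolynomial q a).natDegree ≤ 2 * t - 1 := by
  refine Polynomial.natDegree_sum_le_of_forall_le _ _ fun i _ => ?_
  refine Polynomial.natDegree_add_le_of_degree_le
    ((Polynomial.natDegree_C_mul_X_pow_le _ _).trans ?_)
    ((Polynomial.natDegree_C_mul_X_pow_le _ _).trans ?_) <;> omega

/-- The relative trace of a Niho-type sum vanishes exactly at the roots of `nihoPolynomial`. -/
lemma add_pow_eq_zero_iff_eval_nihoPolynomial {p m : ℕ} [Fact p.Prime] {F : Type*} [Field F]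
    [CharP F p] {t : ℕ} (a y : Fin t → F) (g v : Fˣ)
    (hy : ∀ i, y i = ↑(g * v ^ ((i : ℤ) + 1)))
    (hyq : ∀ i, y i ^ p ^ m = ↑(g * v ^ (-(i : ℤ)))) :
    (∑ i, a i * y i) + (∑ i, a i * y i) ^ p ^ m = 0 ↔
      (nihoPolynomial (p ^ m) a).eval (v : F) = 0 := by
  have key : ((∑ i, a i * y i) + (∑ i, a i * y i) ^ p ^ m) * ((v ^ ((t : ℤ) - 1) : Fˣ) : F) =
      (g : F) * (nihoPolynomial (p ^ m) a).eval (v : F) := by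
    rw [sum_pow_char_pow, ← Finset.sum_add_distrib, Finset.sum_mul, nihoPolynomial,
      Polynomial.eval_finsetSum, Finset.mul_sum]
    refine Finset.sum_congr rfl fun i _ => ?_
    have h1 : (v ^ ((i : ℤ) + 1) * v ^ ((t : ℤ) - 1) : Fˣ) = v ^ (t + i) := by
      rw [← zpow_add, ← zpow_natCast]
      congr 1
      push_cast
      ring
    have h2 : (v ^ (-(i : ℤ)) * v ^ ((t : ℤ) - 1) : Fˣ) = v ^ (t - 1 - i) := by
      rw [← zpow_add, ← zpow_natCast]
      congr 1
      omega
    have h1' := congrArg (Units.val) h1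
    have h2' := congrArg (Units.val) h2
    rw [mul_pow, hy, ← hy, hyq, hy]
    simp only [Units.val_mul, Units.val_pow_eq_pow_val, Polynomial.eval_add, Polynomial.eval_mul,
      Polynomial.eval_C, Polynomial.eval_pow, Polynomial.eval_X] at h1' h2' ⊢
    rw [← h1', ← h2']
    ring
  constructor
  · intro h
    rw [h, zero_mul, eq_comm, mul_eq_zero] at key
    exact key.resolve_left g.ne_zero
  · intro h
    rw [h, mul_zero, mul_eq_zero] at key
    exact key.resolve_right (Units.ne_zero _)

lemma exists_niho_offset {p q h Δ : ℕ} (hq2 : p = 2 → Even q)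
    (hparity : p ≠ 2 → Odd Δ ∧ Odd h) (t : ℕ) (s : ℕ → ℤ)
    (hs : ∀ j, 1 ≤ j → j ≤ t →
      2 * s j ≡ 2 * (j : ℤ) * h + ((Δ : ℤ) - h)
        [ZMOD (if p = 2 then (q : ℤ) + 1 else 2 * ((q : ℤ) + 1))]) :
    ∃ c : ℤ, ((q : ℤ) + 1 ∣ (Δ : ℤ) - h - 2 * c) ∧
      ∀ j, 1 ≤ j → j ≤ t → (q : ℤ) + 1 ∣ s j - (j * h + c) := by
  by_cases hp2 : p = 2
  · obtain ⟨r, hr⟩ := hq2 hp2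
    refine ⟨((Δ : ℤ) - h) * (r + 1), ⟨-((Δ : ℤ) - h), by rw [hr]; push_cast; ring⟩, ?_⟩
    intro j hj1 hjt
    obtain ⟨w, hw⟩ := (hs j hj1 hjt).symm.dvd
    rw [if_pos hp2] at hw
    refine ⟨w * (r + 1) - (s j - j * h), ?_⟩
    rw [hr] at hw ⊢
    push_cast at hw ⊢
    linear_combination (r + 1 : ℤ) * hw
  · obtain ⟨⟨u, hu⟩, ⟨w, hw⟩⟩ := hparity hp2
    refine ⟨(u : ℤ) - w, ⟨0, by rw [hu, hw]; push_cast; ring⟩, ?_⟩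
    intro j hj1 hjt
    obtain ⟨n, hn⟩ := (hs j hj1 hjt).symm.dvd
    rw [if_neg hp2] at hn
    refine ⟨n, ?_⟩
    have hΔ : (Δ : ℤ) = 2 * u + 1 := by exact_mod_cast hu
    have hh : (h : ℤ) = 2 * w + 1 := by exact_mod_cast hw
    linarith

/-- Powers of units of `𝔽_{q²}` depend only on the exponent modulo `q² - 1`. -/
lemma zpow_eq_zpow_of_dvd {F : Type*} [Field F] [Fintype F] {q : ℕ}
    (hF : Fintype.card F = q ^ 2) (x : Fˣ) {a b : ℤ} (hab : (q : ℤ) ^ 2 - 1 ∣ a - b) :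
    x ^ a = x ^ b := by
  classical
  have hq : 1 ≤ q ^ 2 := hF ▸ Fintype.card_pos
  have hx : x ^ ((q : ℤ) ^ 2 - 1) = 1 := by
    have h1 : x ^ (q ^ 2 - 1) = 1 := by rw [← hF, ← Fintype.card_units, pow_card_eq_one]
    rw [← h1, ← zpow_natCast]
    push_cast [hq]
    rfl
  obtain ⟨n, hn⟩ := hab
  rw [← sub_add_cancel a b, hn, zpow_add, zpow_mul, hx, one_zpow, one_mul]

/-- Homogeneity of a generalized Niho exponent with respect to `𝔽_q`-scalars. -/
lemma pow_eq_pow_of_modEq_sub_one {F : Type*} [Field F] {q d Δ : ℕ} {s : ℤ} (k : Fˣ)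
    (hk : k ^ (q - 1) = 1) (hq : 1 ≤ q)
    (hd : (d : ℤ) ≡ s * ((q : ℤ) - 1) + Δ [ZMOD ((q : ℤ) ^ 2 - 1)]) : k ^ d = k ^ Δ := by
  obtain ⟨n, hn⟩ := hd.symm.dvd
  have hk' : k ^ ((q : ℤ) - 1) = 1 := by
    rw [← hk, ← zpow_natCast, Nat.cast_sub hq, Nat.cast_one]
  have hd' : (d : ℤ) = ((q : ℤ) - 1) * (s + ((q : ℤ) + 1) * n) + Δ := by
    linear_combination hn
  rw [← zpow_natCast, hd', zpow_add, zpow_mul, hk', one_zpow, one_mul, zpow_natCast]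

open Complex in
/-- The key exponential-sum evaluation behind Theorem 1(ii): with `p` prime, `q = p^m`,
`F` the field with `q²` elements and generalized Niho-type exponents `d̃_1, …, d̃_t` as in
the paper, define `S̃(a) = (p-1) + ∑_{λ ∈ F_p^*} ∑_{x ∈ F_{q²}^*} ζ_p^{Tr_{q²/p}(λ ∑_j a_j x^{d̃_j})}`
with `ζ_p = exp(2π√-1/p)`.  If `1 ≤ t ≤ (q+1)/(2e)`, then `S̃(0) = (p-1)q²` and for every
nonzero `a` there exists `0 ≤ j ≤ 2t-1` with `S̃(a) = (je - 1)q(p-1)`. -/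
theorem stmt_9 (p m : ℕ) [hp : Fact p.Prime] (hm : 0 < m) (q : ℕ) (hq : q = p ^ m)
    (F : Type*) [Field F] [Fintype F] [DecidableEq F] [Algebra (ZMod p) F]
    (hF : Fintype.card F = q ^ 2)
    (γ : Fˣ) (hγ : ∀ x : Fˣ, x ∈ Subgroup.zpowers γ)
    (h Δ : ℕ) (hh : 0 < h) (hΔpos : 0 < Δ)
    (hhq : ¬ (q + 1) ∣ h) (hΔ : Nat.gcd Δ (q - 1) = 1)
    (hparity : p ≠ 2 → Odd Δ ∧ Odd h)
    (e : ℕ) (he : e = Nat.gcd h (q + 1))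
    (t : ℕ) (ht1 : 1 ≤ t) (ht : 2 * e * t ≤ q + 1)
    (d : ℕ → ℕ) (s : ℕ → ℤ)
    (hdpos : ∀ j, 1 ≤ j → j ≤ t → 0 < d j)
    (hs : ∀ j, 1 ≤ j → j ≤ t →
      2 * s j ≡ 2 * (j : ℤ) * h + ((Δ : ℤ) - h)
        [ZMOD (if p = 2 then (q : ℤ) + 1 else 2 * ((q : ℤ) + 1))])
    (hd : ∀ j, 1 ≤ j → j ≤ t →
      (d j : ℤ) ≡ s j * ((q : ℤ) - 1) + Δ [ZMOD ((q : ℤ) ^ 2 - 1)])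
    (ζ : ℂ) (hζ : ζ = Complex.exp (2 * Real.pi * Complex.I / p))
    (S : (Fin t → F) → ℂ)
    (hS : ∀ a, S a = ((p : ℂ) - 1) +
      ∑ lam : (ZMod p)ˣ, ∑ x : Fˣ, ζ ^
        (Algebra.trace (ZMod p) F
          (algebraMap (ZMod p) F (lam : ZMod p) *
            ∑ j : Fin t, a j * (x : F) ^ d ((j : ℕ) + 1))).val) :
    S 0 = ((p : ℂ) - 1) * (q : ℂ) ^ 2 ∧
    ∀ a : Fin t → F, a ≠ 0 → ∃ j : ℕ, j ≤ 2 * t - 1 ∧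
      S a = ((((j : ℤ) * e - 1) * q * ((p : ℤ) - 1) : ℤ) : ℂ) := by
  classical
  subst hq
  set q := p ^ m with hqdef
  have : CharP F p := charP_of_injective_algebraMap (algebraMap (ZMod p) F).injective p
  have hq1 : 1 < q := Nat.one_lt_pow hm.ne' hp.out.one_lt
  have hq1' : (1 : ℤ) < q := by exact_mod_cast hq1
  have hqC : ((q : ℂ) - 1) ≠ 0 := by
    rw [sub_ne_zero]
    exact_mod_cast hq1.ne'
  have hcardU : Nat.card Fˣ = q ^ 2 - 1 := by
    rw [Nat.card_units, Nat.card_eq_fintype_card, hF]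
  have hcardUC : (Nat.card Fˣ : ℂ) = (q : ℂ) ^ 2 - 1 := by
    rw [hcardU, Nat.cast_sub (Nat.one_le_pow _ _ (by omega))]
    push_cast
    rfl
  have hcardZ : (Fintype.card (ZMod p)ˣ : ℂ) = (p : ℂ) - 1 := by
    rw [ZMod.card_units, Nat.cast_sub hp.out.one_le, Nat.cast_one]
  refine ⟨?_, fun a ha => ?_⟩
  · rw [hS]
    simp only [Pi.zero_apply, zero_mul, Finset.sum_const_zero, mul_zero, map_zero, ZMod.val_zero,
      pow_zero, Finset.sum_const, nsmul_eq_mul, mul_one, Finset.card_univ]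
    rw [hcardZ, ← Nat.card_eq_fintype_card (α := Fˣ), hcardUC]
    ring
  obtain ⟨c, hc, hsc⟩ := exists_niho_offset (q := q) (Δ := Δ) (h := h)
    (fun h2 => by rw [hqdef, h2]; exact (even_two).pow_of_ne_zero hm.ne') hparity t s hs
  have hζprim : IsPrimitiveRoot ζ p := hζ ▸ Complex.isPrimitiveRoot_exp p hp.out.ne_zero
  have hζ1 : ζ ^ p = 1 := hζprim.pow_eq_one
  let ψ : AddChar F ℂ := (AddChar.zmodChar p hζ1).compAddMonoidHom
    (Algebra.trace (ZMod p) F).toAddMonoidHom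
  have hψ : ∀ z, ψ z = ζ ^ (Algebra.trace (ZMod p) F z).val := fun z => rfl
  have hψ1 : ∀ z, ψ z = 1 ↔ Algebra.trace (ZMod p) F z = 0 := fun z => by
    rw [hψ, hζprim.pow_eq_one_iff_dvd, ← ZMod.val_eq_zero]
    exact ⟨fun h => Nat.eq_zero_of_dvd_of_lt h (ZMod.val_lt _), fun h => h ▸ dvd_zero p⟩
  let K := frobeniusFixedSubfield p m F
  have hKann : ∀ z, (∀ k ∈ K, ψ (k * z) = 1) ↔ z + z ^ q = 0 := fun z => by
    simp only [hψ1]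
    exact trace_mul_frobeniusFixed_eq_zero_iff hF z
  have hKcard : Nat.card K = q := card_frobeniusFixedSubfield hm hF
  have hKucard : Nat.card Kˣ = q - 1 := card_units_frobeniusFixedSubfield hm hF
  let f : Fˣ → F := fun x => ∑ j : Fin t, a j * (x : F) ^ d ((j : ℕ) + 1)
  have hfhom : ∀ (k : Kˣ) (x : Fˣ),
      f (Units.map (K.subtype : K →* F) k * x) = ((k : K) : F) ^ Δ * f x := fun k x => by
    have hk1 : Units.map (K.subtype : K →* F) k ^ (q - 1) = 1 := by
      rw [← map_pow, ← hKucard, pow_card_eq_one', map_one]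
    simp only [f, Finset.mul_sum]
    refine Finset.sum_congr rfl fun j _ => ?_
    have hkd := congrArg Units.val
      (pow_eq_pow_of_modEq_sub_one _ hk1 hq1.le (hd (j + 1) (by omega) (by omega)))
    have hkv : ((Units.map (K.subtype : K →* F) k : Fˣ) : F) = ((k : K) : F) := rfl
    rw [Units.val_pow_eq_pow_val, Units.val_pow_eq_pow_val, hkv] at hkd
    rw [Units.val_mul, hkv, mul_pow, hkd]
    ring
  set N : ℕ := (Finset.univ.filter fun x => f x + f x ^ q = 0).card with hN
  have hsum : ∀ lam : (ZMod p)ˣ,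
      ((q : ℂ) - 1) * ∑ x, ψ (algebraMap (ZMod p) F (lam : ZMod p) * f x) =
        q * N - ((q : ℂ) ^ 2 - 1) := fun lam => by
    set l : F := algebraMap (ZMod p) F (lam : ZMod p) with hl
    have hl0 : l ≠ 0 := by
      rw [hl, map_ne_zero]
      exact lam.ne_zero
    have hlq : l ^ q = l := by rw [hl, ← map_pow, hqdef, ZMod.pow_card_pow]
    have h1 := card_mul_sum_addChar_of_homogeneous K ψ (fun x => l * f x) (Δ := Δ)
      (by rw [hKucard]; exact Nat.Coprime.symm hΔ) (fun k x => by rw [hfhom]; ring)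
    have h2 : ∀ x, l * f x + (l * f x) ^ q = 0 ↔ f x + f x ^ q = 0 := fun x => by
      rw [mul_pow, hlq, ← mul_add, mul_eq_zero, or_iff_right hl0]
    simp only [hKann, h2] at h1
    rw [hKucard, hKcard, hcardUC, Nat.cast_sub hq1.le, Nat.cast_one] at h1
    exact h1
  have hSN : ((q : ℂ) - 1) * S a = ((p : ℂ) - 1) * q * (N - (q - 1)) := by
    have h1 : S a = ((p : ℂ) - 1) + ∑ lam : (ZMod p)ˣ,
        ∑ x, ψ (algebraMap (ZMod p) F (lam : ZMod p) * f x) := hS a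
    rw [h1, mul_add, Finset.mul_sum, Finset.sum_congr rfl fun lam _ => hsum lam,
      Finset.sum_const, nsmul_eq_mul, Finset.card_univ, hcardZ]
    ring
  let φ : Fˣ →* Fˣ := powMonoidHom ((q - 1) * h)
  have hpoint : ∀ x : Fˣ, f x + f x ^ q = 0 ↔
      (nihoPolynomial q a).eval ((φ x : Fˣ) : F) = 0 := fun x => by
    have hφ : φ x = x ^ (((q : ℤ) - 1) * h) := by
      change x ^ ((q - 1) * h) = _
      rw [← zpow_natCast, Nat.cast_mul, Nat.cast_sub hq1.le, Nat.cast_one]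
    obtain ⟨b, hb⟩ := hc
    have hexp : ∀ i : Fin t, ∃ n : ℤ, (d ((i : ℕ) + 1) : ℤ) =
        ((q : ℤ) - 1) * ((i + 1) * h + c) + Δ + ((q : ℤ) ^ 2 - 1) * n := fun i => by
      obtain ⟨n₁, hn₁⟩ := hsc (i + 1) (by omega) (by omega)
      obtain ⟨n₂, hn₂⟩ := (hd (i + 1) (by omega) (by omega)).symm.dvd
      refine ⟨n₁ + n₂, ?_⟩
      push_cast at hn₁
      linear_combination hn₂ + ((q : ℤ) - 1) * hn₁
    refine add_pow_eq_zero_iff_eval_nihoPolynomial a _ (x ^ ((Δ : ℤ) + ((q : ℤ) - 1) * c)) (φ x)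
      (fun i => ?_) (fun i => ?_)
    · obtain ⟨n, hn⟩ := hexp i
      rw [← Units.val_pow_eq_pow_val, Units.val_inj, hφ, ← zpow_natCast, ← zpow_mul, ← zpow_add]
      refine zpow_eq_zpow_of_dvd hF x ⟨n, ?_⟩
      linear_combination hn
    · obtain ⟨n, hn⟩ := hexp i
      rw [← pow_mul, ← Units.val_pow_eq_pow_val, Units.val_inj, hφ, ← zpow_natCast, ← zpow_mul,
        ← zpow_add]
      refine zpow_eq_zpow_of_dvd hF x ⟨(i + 1) * h + c + b + q * n, ?_⟩
      rw [Nat.cast_mul, hn]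
      linear_combination ((q : ℤ) - 1) * hb
  have hker : Nat.card φ.ker = (q - 1) * e := by
    rw [IsCyclic.card_powMonoidHom_ker, hcardU, he, Nat.gcd_comm h,
      show q ^ 2 - 1 = (q - 1) * (q + 1) by rw [mul_comm, ← Nat.sq_sub_sq, one_pow],
      Nat.gcd_mul_left]
  set R := (Finset.univ.image φ).filter fun v : Fˣ => (nihoPolynomial q a).eval (v : F) = 0
    with hR
  have hNR : N = (q - 1) * e * R.card := by
    rw [hN, ← hker, hR,
      ← card_filter_monoidHom φ fun v : Fˣ => (nihoPolynomial q a).eval (v : F) = 0]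
    simp only [hpoint]
  refine ⟨R.card, ?_, ?_⟩
  · refine le_trans ?_ (natDegree_nihoPolynomial_le q a)
    refine le_trans ?_ (Polynomial.card_roots' _)
    refine le_trans ?_ (Multiset.toFinset_card_le _)
    refine Finset.card_le_card_of_injOn (fun v : Fˣ => (v : F)) (fun v hv => ?_)
      (fun _ _ _ _ h => Units.ext h)
    have hv' := (Finset.mem_filter.1 hv).2
    simpa [nihoPolynomial_ne_zero q ha] using hv'
  · apply mul_left_cancel₀ hqC
    rw [hSN, hNR]
    push_cast [hq1.le]
    ring
end
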